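/- Let A be a Δ̄-filtered finite-dimensional basic K-algebra, fix 1 ≤ i ≤ n, let E = End_A(Δ(i))^{op} (a local finite-dimensional K-algebra) and let S_E = E/rad E be its simple module, which is isomorphic to Hom_A(Δ(i), Δ̄(i)). Then there is an isomorphism of ℤ-graded K-algebras Ext^*_A(Δ̄(i),Δ̄(i)) ≅ Ext^*_E(S_E,S_E). -/

import Mathlib

/-!
STATEMENT 11.

`A` is a finite-dimensional basic `K`-algebra (`K` algebraically closed) with a complete set
of pairwise orthogonal primitive idempotents `e 0, …, e (n-1)` giving pairwise
non-isomorphic projectives `P(i) = Ae_i` (encoded as `leftIdeal A (e i)`); `rad A` is the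
intersection of the maximal left ideals, `Δ̄(i) = P(i)/U(i)` is the properly standard module
and `Δ(i)` the standard module; `A` is assumed `Δ̄`-filtered.  `E := End_A(Δ(i))ᵒᵖ` and
`S_E := E/rad E` is its simple module.

`Ext^*` algebras are encoded via chosen projective resolutions: `Ext^k` is the space of
degree-`k` chain maps of the resolution modulo the null-homotopic ones (the statement
quantifies over arbitrary chosen projective resolutions, over `A` of `Δ̄(i)` and over `E` of
`S_E`), and an isomorphism of ℤ-graded `K`-algebras is a family of `K`-linear bijections in
each degree preserving the unit and compatible with the Yoneda products (composition of
chain maps); this is the predicate `IsGradedExtAlgIso`.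
-/

noncomputable section

def mulRightLin (A : Type*) [Ring A] (a : A) : A →ₗ[A] A where
  toFun x := x * a
  map_add' x y := add_mul x y a
  map_smul' r x := by simp [smul_eq_mul, mul_assoc]

def leftIdeal (A : Type*) [Ring A] (a : A) : Submodule A A := LinearMap.range (mulRightLin A a)

def jacRad (A : Type*) [Ring A] : Ideal A := sInf {I : Ideal A | I.IsMaximal}

def radM (A : Type*) [Ring A] (M : Type*) [AddCommGroup M] [Module A M] : Submodule A M :=
  Submodule.span A {x | ∃ r ∈ jacRad A, ∃ m : M, x = r • m}

def IsRadHom (A : Type*) [Ring A] {M N : Type*} [AddCommGroup M] [Module A M]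
    [AddCommGroup N] [Module A N] (f : M →ₗ[A] N) : Prop :=
  LinearMap.range f ≤ radM A N

def IsPrimitiveIdem (A : Type*) [Ring A] (x : A) : Prop :=
  IsIdempotentElem x ∧ x ≠ 0 ∧ ∀ y z : A, IsIdempotentElem y → IsIdempotentElem z →
    y * z = 0 → z * y = 0 → x = y + z → y = 0 ∨ z = 0

/-- `U(i)`: the sum of the images of all radical maps `P(j) → P(i)` with `j ≥ i` -/
def properU (A : Type*) [Ring A] {n : ℕ} (e : Fin n → A) (i : Fin n) :
    Submodule A ↥(leftIdeal A (e i)) :=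
  ⨆ (j : Fin n) (_ : i ≤ j) (φ : ↥(leftIdeal A (e j)) →ₗ[A] ↥(leftIdeal A (e i)))
    (_ : IsRadHom A φ), LinearMap.range φ

/-- the properly standard module `Δ̄(i) = P(i)/U(i)` -/
abbrev PStd (A : Type*) [Ring A] {n : ℕ} (e : Fin n → A) (i : Fin n) :=
  ↥(leftIdeal A (e i)) ⧸ properU A e i

/-- the sum of the images of all maps `P(j) → P(i)` with `j > i` -/
def stdU (A : Type*) [Ring A] {n : ℕ} (e : Fin n → A) (i : Fin n) :
    Submodule A ↥(leftIdeal A (e i)) :=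
  ⨆ (j : Fin n) (_ : i < j) (φ : ↥(leftIdeal A (e j)) →ₗ[A] ↥(leftIdeal A (e i))),
    LinearMap.range φ

/-- the standard module `Δ(i)` -/
abbrev Std (A : Type*) [Ring A] {n : ℕ} (e : Fin n → A) (i : Fin n) :=
  ↥(leftIdeal A (e i)) ⧸ stdU A e i

/-- `E = End_A(Δ(i))ᵒᵖ` -/
abbrev EndOpStd (A : Type*) [Ring A] {n : ℕ} (e : Fin n → A) (i : Fin n) :=
  (Module.End A (Std A e i))ᵐᵒᵖ

/-- `S_E = E / rad E`, the simple `E`-module -/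
abbrev SimpleE (A : Type*) [Ring A] {n : ℕ} (e : Fin n → A) (i : Fin n) :=
  (EndOpStd A e i) ⧸ (jacRad (EndOpStd A e i))

/-- `M` has a finite filtration with subquotients among the `Δ̄(j)`, `j` satisfying `cond` -/
def HasPStdFilt (A : Type u) [Ring A] {n : ℕ} (e : Fin n → A) (cond : Fin n → Prop)
    (M : Type u) [AddCommGroup M] [Module A M] : Prop :=
  ∃ (m : ℕ) (X : ℕ → Submodule A M), X 0 = ⊤ ∧ X m = ⊥ ∧ (∀ t, X (t + 1) ≤ X t) ∧
    ∀ t < m, ∃ j, cond j ∧ Nonempty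
      ((↥(X t) ⧸ Submodule.comap (X t).subtype (X (t + 1))) ≃ₗ[A] PStd A e j)

section ExtMachinery

variable {A : Type*} [Ring A]
variable (P : ℕ → Type*) [∀ l, AddCommGroup (P l)] [∀ l, Module A (P l)]

/-- transport along an equality of indices -/
def pcast {a b : ℕ} (h : a = b) : P a →ₗ[A] P b := by subst h; exact LinearMap.id

/-- the space `𝒜^k = Hom_A(P•,P•[k])` of degree-`k` families of maps, an element being the
family of its components `g^{(k+m)} : P_{k+m} → P_m` -/
abbrev ExtDeg (A : Type*) [Ring A] (P : ℕ → Type*) [∀ l, AddCommGroup (P l)]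
    [∀ l, Module A (P l)] (k : ℕ) := ∀ m : ℕ, P (k + m) →ₗ[A] P m

variable (dP : ∀ l, P (l + 1) →ₗ[A] P l)

/-- the chain-map condition `g^{(l)} ∘ ∂_{l+1} = (-1)^k ∂_{l-k+1} ∘ g^{(l+1)}` -/
def IsChainMap (k : ℕ) (g : ExtDeg A P k) : Prop :=
  ∀ m, (g m) ∘ₗ (dP (k + m)) = ((-1 : ℤ) ^ k) • ((dP m) ∘ₗ (g (m + 1)))

/-- null-homotopy: for `k ≥ 1`, `g^{(l)} = ∂_{l-k+1} ∘ u^{(l)} - (-1)^(k-1) u^{(l-1)} ∘ ∂_l`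
with `u^{(l)} : P_l → P_{l-k+1}` (encoded as `h m := u^{(m+k-1)}`); for `k = 0` the same with
`u^{(l)} : P_l → P_{l+1}` (encoded as `h m := u^{(m)}`) and `u^{(-1)} = 0`. -/
def IsNullMap : (k : ℕ) → ExtDeg A P k → Prop
  | 0, g => ∃ h : ∀ m, P m →ₗ[A] P (m + 1),
      (g 0 = dP 0 ∘ₗ h 0 ∘ₗ pcast P (by omega : (0 : ℕ) + 0 = 0)) ∧
      ∀ m, g (m + 1) = (dP (m + 1) ∘ₗ h (m + 1) + h m ∘ₗ dP m) ∘ₗ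
        pcast P (by omega : 0 + (m + 1) = m + 1)
  | (k' + 1), g => ∃ h : ∀ m, P (k' + m) →ₗ[A] P m,
      ∀ m, g m = (dP m ∘ₗ h (m + 1)) ∘ₗ pcast P (by omega : (k' + 1) + m = k' + (m + 1)) -
        ((-1 : ℤ) ^ k') • ((h m ∘ₗ dP (k' + m)) ∘ₗ
          pcast P (by omega : (k' + 1) + m = (k' + m) + 1))

variable (K : Type*) [Field K] [Algebra K A]
  [∀ l, Module K (P l)] [∀ l, IsScalarTower K A (P l)] [∀ l, SMulCommClass A K (P l)]

/-- the `K`-subspace of chain maps (the set of chain maps is a subspace, so taking the span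
does not change it) -/
def chainSub (k : ℕ) : Submodule K (ExtDeg A P k) :=
  Submodule.span K {g | IsChainMap P dP k g}

/-- the `K`-subspace of null-homotopic families -/
def nullSub (k : ℕ) : Submodule K (ExtDeg A P k) :=
  Submodule.span K {g | IsNullMap P dP k g}

/-- `Ext^k`: chain maps modulo null-homotopic chain maps, computed from the chosen
projective resolution `P•` -/
abbrev extQ (k : ℕ) := ↥(chainSub P dP K k) ⧸
  (Submodule.comap (chainSub P dP K k).subtype (nullSub P dP K k))

/-- the class in `Ext^k` of a chain map -/
def extMk (k : ℕ) (g : ExtDeg A P k) (hg : IsChainMap P dP k g) : extQ P dP K k :=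
  Submodule.Quotient.mk ⟨g, Submodule.subset_span hg⟩

/-- composition of degree-`j` and degree-`k` elements (the Yoneda product on `Ext`) -/
def extComp {j k : ℕ} (f : ExtDeg A P j) (g : ExtDeg A P k) : ExtDeg A P (j + k) :=
  fun m => (f m ∘ₗ g (j + m)) ∘ₗ pcast P (by omega : (j + k) + m = k + (j + m))

/-- the identity chain map, of degree `0` -/
def extId : ExtDeg A P 0 := fun m => pcast P (by omega : 0 + m = m)

end ExtMachinery

/-- A family of `K`-linear bijections `Ext^k_A(M,M) ≅ Ext^k_B(N,N)` (computed from chosen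
projective resolutions `P•` of `M` over `A` and `P'•` of `N` over `B`) is an isomorphism of
ℤ-graded `K`-algebras: it sends the identity to the identity and is compatible with the
Yoneda products (composition of chain maps). -/
def IsGradedExtAlgIso
    {A : Type*} [Ring A] (P : ℕ → Type*) [∀ l, AddCommGroup (P l)] [∀ l, Module A (P l)]
    (dP : ∀ l, P (l + 1) →ₗ[A] P l)
    {B : Type*} [Ring B] (P' : ℕ → Type*) [∀ l, AddCommGroup (P' l)] [∀ l, Module B (P' l)]
    (dP' : ∀ l, P' (l + 1) →ₗ[B] P' l)
    (K : Type*) [Field K] [Algebra K A] [Algebra K B]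
    [∀ l, Module K (P l)] [∀ l, IsScalarTower K A (P l)] [∀ l, SMulCommClass A K (P l)]
    [∀ l, Module K (P' l)] [∀ l, IsScalarTower K B (P' l)] [∀ l, SMulCommClass B K (P' l)]
    (φ : ∀ k, extQ P dP K k ≃ₗ[K] extQ P' dP' K k) : Prop :=
  (∀ (hid : IsChainMap P dP 0 (extId P)) (hid' : IsChainMap P' dP' 0 (extId P')),
      φ 0 (extMk P dP K 0 (extId P) hid) = extMk P' dP' K 0 (extId P') hid') ∧
  (∀ (j k : ℕ) (x : ExtDeg A P j) (y : ExtDeg A P k)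
      (hx : IsChainMap P dP j x) (hy : IsChainMap P dP k y)
      (hxy : IsChainMap P dP (j + k) (extComp P x y))
      (x' : ExtDeg B P' j) (y' : ExtDeg B P' k)
      (hx' : IsChainMap P' dP' j x') (hy' : IsChainMap P' dP' k y')
      (hxy' : IsChainMap P' dP' (j + k) (extComp P' x' y')),
      φ j (extMk P dP K j x hx) = extMk P' dP' K j x' hx' →
      φ k (extMk P dP K k y hy) = extMk P' dP' K k y' hy' →
      φ (j + k) (extMk P dP K (j + k) (extComp P x y) hxy) =
        extMk P' dP' K (j + k) (extComp P' x' y') hxy')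

section FactorThrough

variable {A : Type*} [Ring A] {X Y Z : Type*} [AddCommGroup X] [Module A X]
  [AddCommGroup Y] [Module A Y] [AddCommGroup Z] [Module A Z]

/-- A linear map killing the kernel of a surjection factors through it. -/
theorem exists_factor_of_ker_le (p : X →ₗ[A] Y) (hp : Function.Surjective p) (f : X →ₗ[A] Z)
    (h : ∀ x, p x = 0 → f x = 0) : ∃ g : Y →ₗ[A] Z, g ∘ₗ p = f := by
  refine ⟨(LinearMap.ker p).liftQ f (fun x hx => by simpa using h x (by simpa using hx)) ∘ₗ
    (p.quotKerEquivOfSurjective hp).symm.toLinearMap, ?_⟩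
  ext x
  have : (p.quotKerEquivOfSurjective hp).symm (p x) = (LinearMap.ker p).mkQ x := by
    rw [LinearEquiv.symm_apply_eq]; rfl
  simp [this]

/-- Linear maps out of a projective module lift along maps whose range contains the image. -/
theorem exists_lift_of_range_le [Module.Projective A X] (f : X →ₗ[A] Z) (g : Y →ₗ[A] Z)
    (h : ∀ x, ∃ y, g y = f x) : ∃ l : X →ₗ[A] Y, g ∘ₗ l = f := by
  obtain ⟨l, hl⟩ := Module.projective_lifting_property g.rangeRestrict
    (f.codRestrict (LinearMap.range g) (fun x => by simpa using h x)) g.surjective_rangeRestrict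
  refine ⟨l, ?_⟩
  ext x
  have := congrArg Subtype.val (LinearMap.congr_fun hl x)
  simpa using this

/-- Two surjections with the same kernel have isomorphic targets, compatibly. -/
theorem exists_linearEquiv_of_same_ker (p : X →ₗ[A] Y) (hp : Function.Surjective p)
    (q : X →ₗ[A] Z) (hq : Function.Surjective q) (h : ∀ x, p x = 0 ↔ q x = 0) :
    ∃ ι : Y ≃ₗ[A] Z, ∀ x, ι (p x) = q x := by
  obtain ⟨f, hf⟩ := exists_factor_of_ker_le p hp q (fun x hx => (h x).1 hx)
  have hf' : ∀ x, f (p x) = q x := fun x => LinearMap.congr_fun hf x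
  refine ⟨LinearEquiv.ofBijective f ⟨?_, ?_⟩, hf'⟩
  · rw [injective_iff_map_eq_zero]
    intro y hy
    obtain ⟨x, rfl⟩ := hp y
    rw [hf'] at hy
    exact (h x).2 hy
  · intro z
    obtain ⟨x, rfl⟩ := hq z
    exact ⟨p x, hf' x⟩

end FactorThrough

/-- An injective coresolution `0 → L → I 0 → I 1 → ⋯`. -/
structure InjCoresolution (A : Type u) [Ring A] (L : Type u) [AddCommGroup L] [Module A L] where
  I : ℕ → Type u
  [acg : ∀ t, AddCommGroup (I t)]
  [mod : ∀ t, Module A (I t)]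
  d : ∀ t, I t →ₗ[A] I (t + 1)
  η : L →ₗ[A] I 0
  injective : ∀ t, Module.Injective A (I t)
  η_injective : Function.Injective η
  exact_zero : Function.Exact η (d 0)
  exact_succ : ∀ t, Function.Exact (d t) (d (t + 1))

attribute [instance] InjCoresolution.acg InjCoresolution.mod

namespace InjCoresolution

open CategoryTheory in
theorem nonempty (A : Type u) [Ring A] (L : Type u) [AddCommGroup L] [Module A L] :
    Nonempty (InjCoresolution A L) := by
  let emb (N : ModuleCat.{u} A) : N →ₗ[A] (Injective.under N : ModuleCat.{u} A) :=
    (Injective.ι N).hom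
  have emb_inj (N : ModuleCat.{u} A) : Function.Injective (emb N) :=
    (ModuleCat.mono_iff_injective (Injective.ι N)).1 inferInstance
  let next (N : ModuleCat.{u} A) : ModuleCat.{u} A :=
    ModuleCat.of A ((Injective.under N : ModuleCat.{u} A) ⧸ LinearMap.range (emb N))
  let q (N : ModuleCat.{u} A) : (Injective.under N : ModuleCat.{u} A) →ₗ[A] next N :=
    (LinearMap.range (emb N)).mkQ
  have q_surj (N : ModuleCat.{u} A) : Function.Surjective (q N) := Submodule.mkQ_surjective _
  have q_zero (N : ModuleCat.{u} A) (x) : q N x = 0 ↔ x ∈ LinearMap.range (emb N) :=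
    Submodule.Quotient.mk_eq_zero _
  let N : ℕ → ModuleCat.{u} A := fun t => Nat.rec (ModuleCat.of A L) (fun _ N => next N) t
  refine ⟨⟨fun t => (Injective.under (N t) : ModuleCat.{u} A),
    fun t => emb (next (N t)) ∘ₗ q (N t), emb (N 0), ?_, ?_, ?_, ?_⟩⟩
  · intro t
    have : Injective (ModuleCat.of A (Injective.under (N t) : ModuleCat.{u} A)) :=
      Injective.injective_under (N t)
    exact Module.injective_module_of_injective_object A _
  · exact emb_inj _
  · intro x
    rw [LinearMap.comp_apply, map_eq_zero_iff _ (emb_inj _), q_zero]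
    rfl
  · intro t x
    rw [LinearMap.comp_apply, map_eq_zero_iff _ (emb_inj _), q_zero]
    constructor
    · rintro ⟨y, rfl⟩
      obtain ⟨z, rfl⟩ := q_surj _ y
      exact ⟨z, rfl⟩
    · rintro ⟨z, rfl⟩
      exact ⟨_, rfl⟩

variable {A : Type u} [Ring A] {L : Type u} [AddCommGroup L] [Module A L]
  (R : InjCoresolution A L)

theorem d_d (t : ℕ) (x : R.I t) : R.d (t + 1) (R.d t x) = 0 :=
  (R.exact_succ t).apply_apply_eq_zero x

theorem exists_extension {M' M : Type u} [AddCommGroup M'] [Module A M'] [AddCommGroup M]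
    [Module A M] (i : M' →ₗ[A] M) (hi : Function.Injective i) {t : ℕ} (f : M' →ₗ[A] R.I t) :
    ∃ g : M →ₗ[A] R.I t, g ∘ₗ i = f := by
  obtain ⟨g, hg⟩ := (R.injective t).out i hi f
  exact ⟨g, LinearMap.ext hg⟩

/-- Vanishing of `Ext^t(M, L)`, computed from an injective coresolution of `L`. -/
def ExtVanish : ℕ → ∀ (M : Type u) [AddCommGroup M] [Module A M], Prop
  | 0, M, _, _ => ∀ f : M →ₗ[A] R.I 0, R.d 0 ∘ₗ f = 0 → f = 0
  | t + 1, M, _, _ => ∀ f : M →ₗ[A] R.I (t + 1), R.d (t + 1) ∘ₗ f = 0 →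
      ∃ g : M →ₗ[A] R.I t, R.d t ∘ₗ g = f

/-- `M` is acyclic for `Hom(-, L)`: all positive `Ext`-groups vanish. -/
def Acyclic (M : Type u) [AddCommGroup M] [Module A M] : Prop := ∀ t, R.ExtVanish (t + 1) M

section

variable {R} {M' M M'' : Type u} [AddCommGroup M'] [Module A M'] [AddCommGroup M] [Module A M]
  [AddCommGroup M''] [Module A M'']

theorem extVanish_zero_of_hom_eq_zero (h : ∀ f : M →ₗ[A] L, f = 0) : R.ExtVanish 0 M := by
  intro f hf
  have hf' : ∀ x, R.d 0 (f x) = 0 := fun x => LinearMap.congr_fun hf x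
  have hr : ∀ x, f x ∈ LinearMap.range R.η := fun x => (R.exact_zero _).1 (hf' x)
  have e := LinearEquiv.ofInjective R.η R.η_injective
  have h0 := h ((LinearEquiv.ofInjective R.η R.η_injective).symm.toLinearMap ∘ₗ
    f.codRestrict _ hr)
  ext x
  have h1 := LinearMap.congr_fun h0 x
  simp only [LinearMap.comp_apply, LinearEquiv.coe_coe, LinearMap.zero_apply,
    LinearEquiv.map_eq_zero_iff] at h1
  simpa using congrArg Subtype.val h1

theorem ExtVanish.of_equiv {t : ℕ} (e : M ≃ₗ[A] M') (h : R.ExtVanish t M) :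
    R.ExtVanish t M' := by
  have hc : ∀ {N : Type u} [AddCommGroup N] [Module A N] (f : M' →ₗ[A] N),
      (f ∘ₗ e.toLinearMap) ∘ₗ e.symm.toLinearMap = f := by
    intro N _ _ f; ext x; simp
  cases t with
  | zero =>
    intro f hf
    have := h (f ∘ₗ e.toLinearMap) (by rw [← LinearMap.comp_assoc, hf, LinearMap.zero_comp])
    rw [← hc f, this, LinearMap.zero_comp]
  | succ t =>
    intro f hf
    obtain ⟨g, hg⟩ := h (f ∘ₗ e.toLinearMap)
      (by rw [← LinearMap.comp_assoc, hf, LinearMap.zero_comp])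
    exact ⟨g ∘ₗ e.symm.toLinearMap, by rw [← LinearMap.comp_assoc, hg, hc]⟩

theorem ExtVanish.of_retract {t : ℕ} (i : M' →ₗ[A] M) (r : M →ₗ[A] M')
    (hri : r ∘ₗ i = LinearMap.id) (h : R.ExtVanish (t + 1) M) : R.ExtVanish (t + 1) M' := by
  intro f hf
  obtain ⟨g, hg⟩ := h (f ∘ₗ r) (by rw [← LinearMap.comp_assoc, hf, LinearMap.zero_comp])
  exact ⟨g ∘ₗ i, by rw [← LinearMap.comp_assoc, hg, LinearMap.comp_assoc, hri,
    LinearMap.comp_id]⟩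

theorem extVanish_of_subsingleton [Subsingleton M] (t : ℕ) : R.ExtVanish t M := by
  cases t with
  | zero => intro f _; exact LinearMap.ext fun x => by simp [Subsingleton.elim x 0]
  | succ t => intro f _; exact ⟨0, LinearMap.ext fun x => by simp [Subsingleton.elim x 0]⟩

theorem Acyclic.of_projective [Module.Projective A M] : R.Acyclic M := by
  intro t f hf
  exact exists_lift_of_range_le f (R.d t)
    (fun x => (R.exact_succ t _).1 (LinearMap.congr_fun hf x))

theorem Acyclic.prod (h : R.Acyclic M) (h' : R.Acyclic M') : R.Acyclic (M × M') := by
  intro t f hf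
  obtain ⟨g, hg⟩ := h t (f ∘ₗ LinearMap.inl A M M')
    (by rw [← LinearMap.comp_assoc, hf, LinearMap.zero_comp])
  obtain ⟨g', hg'⟩ := h' t (f ∘ₗ LinearMap.inr A M M')
    (by rw [← LinearMap.comp_assoc, hf, LinearMap.zero_comp])
  refine ⟨g.coprod g', ?_⟩
  rw [LinearMap.comp_coprod, hg, hg', ← LinearMap.comp_coprod, LinearMap.coprod_inl_inr,
    LinearMap.comp_id]

variable {i : M' →ₗ[A] M} {p : M →ₗ[A] M''}

theorem ExtVanish.extension {t : ℕ} (hi : Function.Injective i) (hp : Function.Surjective p)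
    (hex : Function.Exact i p) (h' : R.ExtVanish t M') (h'' : R.ExtVanish t M'') :
    R.ExtVanish t M := by
  cases t with
  | zero =>
    intro f hf
    have h0 := h' (f ∘ₗ i) (by rw [← LinearMap.comp_assoc, hf, LinearMap.zero_comp])
    obtain ⟨g, rfl⟩ := exists_factor_of_ker_le p hp f (fun x hx => by
      obtain ⟨y, rfl⟩ := (hex x).1 hx
      exact LinearMap.congr_fun h0 y)
    rw [h'' g, LinearMap.zero_comp]
    ext y
    obtain ⟨x, rfl⟩ := hp y
    exact LinearMap.congr_fun hf x
  | succ t =>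
    intro f hf
    obtain ⟨g, hg⟩ := h' (f ∘ₗ i) (by rw [← LinearMap.comp_assoc, hf, LinearMap.zero_comp])
    obtain ⟨g', rfl⟩ := R.exists_extension i hi g
    obtain ⟨k, hk⟩ := exists_factor_of_ker_le p hp (f - R.d t ∘ₗ g') (fun x hx => by
      obtain ⟨y, rfl⟩ := (hex x).1 hx
      have := LinearMap.congr_fun hg y
      simp only [LinearMap.comp_apply] at this
      simp [this])
    have hfx : ∀ x, R.d (t + 1) (f x) = 0 := fun x => LinearMap.congr_fun hf x
    obtain ⟨H, hH⟩ := h'' k (by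
      ext y
      obtain ⟨x, rfl⟩ := hp y
      have := LinearMap.congr_fun hk x
      simp only [LinearMap.comp_apply] at this
      simp [this, hfx, R.d_d])
    refine ⟨g' + H ∘ₗ p, ?_⟩
    rw [LinearMap.comp_add, ← LinearMap.comp_assoc, hH, hk]
    abel

/-- Dimension shifting: cocycles on the kernel extend up to a coboundary. -/
theorem Acyclic.exists_of_ker (hi : Function.Injective i) (hp : Function.Surjective p)
    (hex : Function.Exact i p) (h : R.Acyclic M) (h'' : R.Acyclic M'') (t : ℕ)
    (f : M' →ₗ[A] R.I (t + 1)) (hf : R.d (t + 1) ∘ₗ f = 0) :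
    ∃ g : M →ₗ[A] R.I t, (R.d t ∘ₗ g) ∘ₗ i = f := by
  obtain ⟨F, rfl⟩ := R.exists_extension i hi f
  obtain ⟨G, hG⟩ := exists_factor_of_ker_le p hp (R.d (t + 1) ∘ₗ F) (fun x hx => by
      obtain ⟨y, rfl⟩ := (hex x).1 hx
      exact LinearMap.congr_fun hf y)
  have hG' : ∀ x, G (p x) = R.d (t + 1) (F x) := fun x => LinearMap.congr_fun hG x
  obtain ⟨H, hH⟩ := h'' (t + 1) G (by
    ext y
    obtain ⟨x, rfl⟩ := hp y
    simp [hG', R.d_d])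
  have hH' : ∀ x, R.d (t + 1) (H x) = G x := fun x => LinearMap.congr_fun hH x
  obtain ⟨g, hg⟩ := h t (F - H ∘ₗ p) (by
    ext x
    simp [hH', hG'])
  refine ⟨g, ?_⟩
  rw [hg]
  ext x
  simp [hex.apply_apply_eq_zero]

theorem Acyclic.of_ker (hi : Function.Injective i) (hp : Function.Surjective p)
    (hex : Function.Exact i p) (h : R.Acyclic M) (h'' : R.Acyclic M'') : R.Acyclic M' := by
  intro t f hf
  obtain ⟨g, hg⟩ := Acyclic.exists_of_ker hi hp hex h h'' t f hf
  exact ⟨g ∘ₗ i, hg⟩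

/-- If `M''` is acyclic, maps from the kernel to `L` extend. -/
theorem Acyclic.exists_extension (hi : Function.Injective i) (hp : Function.Surjective p)
    (hex : Function.Exact i p) (h'' : R.Acyclic M'') (f : M' →ₗ[A] L) :
    ∃ g : M →ₗ[A] L, g ∘ₗ i = f := by
  obtain ⟨F, hF⟩ := R.exists_extension i hi (R.η ∘ₗ f)
  have hF' : ∀ x, F (i x) = R.η (f x) := fun x => LinearMap.congr_fun hF x
  obtain ⟨G, hG⟩ := exists_factor_of_ker_le p hp (R.d 0 ∘ₗ F) (fun x hx => by
      obtain ⟨y, rfl⟩ := (hex x).1 hx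
      simp [hF', R.exact_zero.apply_apply_eq_zero])
  have hG' : ∀ x, G (p x) = R.d 0 (F x) := fun x => LinearMap.congr_fun hG x
  obtain ⟨H, hH⟩ := h'' 0 G (by
    ext y
    obtain ⟨x, rfl⟩ := hp y
    simp [hG', R.d_d])
  have hH' : ∀ x, R.d 0 (H x) = G x := fun x => LinearMap.congr_fun hH x
  have hr : ∀ x, (F - H ∘ₗ p) x ∈ LinearMap.range R.η := fun x =>
    (R.exact_zero _).1 (by simp [hH', hG'])
  refine ⟨(LinearEquiv.ofInjective R.η R.η_injective).symm.toLinearMap ∘ₗ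
    (F - H ∘ₗ p).codRestrict _ hr, ?_⟩
  ext x
  simp only [LinearMap.comp_apply, LinearEquiv.coe_coe, LinearEquiv.symm_apply_eq]
  ext
  simp [hF', hex.apply_apply_eq_zero]

theorem ExtVanish.of_coker {t : ℕ} (hi : Function.Injective i) (hp : Function.Surjective p)
    (hex : Function.Exact i p) (h' : R.ExtVanish t M') (h : R.ExtVanish (t + 1) M) :
    R.ExtVanish (t + 1) M'' := by
  intro f hf
  obtain ⟨g, hg⟩ := h (f ∘ₗ p) (by rw [← LinearMap.comp_assoc, hf, LinearMap.zero_comp])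
  have hg' : ∀ x, R.d t (g x) = f (p x) := fun x => LinearMap.congr_fun hg x
  have hgi : R.d t ∘ₗ (g ∘ₗ i) = 0 := by
    ext x
    simp [hg', hex.apply_apply_eq_zero]
  obtain ⟨g₁, hg₁, hg₁i⟩ : ∃ g₁ : M →ₗ[A] R.I t, R.d t ∘ₗ g₁ = f ∘ₗ p ∧ g₁ ∘ₗ i = 0 := by
    cases t with
    | zero => exact ⟨g, hg, h' _ hgi⟩
    | succ t =>
      obtain ⟨k, hk⟩ := h' _ hgi
      obtain ⟨k', rfl⟩ := R.exists_extension i hi k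
      refine ⟨g - R.d t ∘ₗ k', ?_, ?_⟩
      · ext x
        simp [hg', R.d_d]
      · rw [LinearMap.sub_comp, LinearMap.comp_assoc, hk, sub_self]
  obtain ⟨G, rfl⟩ := exists_factor_of_ker_le p hp g₁ (fun x hx => by
      obtain ⟨y, rfl⟩ := (hex x).1 hx
      exact LinearMap.congr_fun hg₁i y)
  refine ⟨G, ?_⟩
  ext y
  obtain ⟨x, rfl⟩ := hp y
  exact LinearMap.congr_fun hg₁ x

end

end InjCoresolution

theorem exists_dependent_seq {T : ℕ → Type*} (t₀ : T 0) (r : ∀ m, T m → T (m + 1) → Prop)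
    (h : ∀ m t, ∃ t', r m t t') : ∃ f : ∀ m, T m, f 0 = t₀ ∧ ∀ m, r m (f m) (f (m + 1)) := by
  choose F hF using h
  exact ⟨fun m => Nat.rec t₀ F m, rfl, fun m => hF m _⟩

section Pcast

variable {A : Type*} [Ring A] {P : ℕ → Type*} [∀ l, AddCommGroup (P l)] [∀ l, Module A (P l)]

theorem pcast_self {a : ℕ} (h : a = a) (x : P a) : pcast (A := A) P h x = x := rfl

theorem pcast_pcast {a b c : ℕ} (h : a = b) (h' : b = c) (x : P a) :
    pcast (A := A) P h' (pcast (A := A) P h x) = pcast (A := A) P (h.trans h') x := by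
  subst h; subst h'; rfl

theorem d_pcast (dP : ∀ l, P (l + 1) →ₗ[A] P l) {a b : ℕ} (h : a + 1 = b + 1) (h' : a = b)
    (x : P (a + 1)) : dP b (pcast (A := A) P h x) = pcast (A := A) P h' (dP a x) := by
  subst h'; rfl

end Pcast

section Cob

variable {A : Type*} [Ring A] {X : ℕ → Type*} [∀ l, AddCommGroup (X l)] [∀ l, Module A (X l)]
  (dX : ∀ l, X (l + 1) →ₗ[A] X l) {N : Type*} [AddCommGroup N] [Module A N]

/-- The coboundaries in the complex `Hom(X•, N)`. -/
def IsCob : ∀ a : ℕ, (X a →ₗ[A] N) → Prop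
  | 0, γ => γ = 0
  | a + 1, γ => ∃ c : X a →ₗ[A] N, γ = c ∘ₗ dX a

variable {dX}

theorem IsCob.zero (a : ℕ) : IsCob dX a (0 : X a →ₗ[A] N) := by
  cases a with
  | zero => rfl
  | succ a => exact ⟨0, by simp⟩

theorem IsCob.add {a : ℕ} {γ γ' : X a →ₗ[A] N} (h : IsCob dX a γ) (h' : IsCob dX a γ') :
    IsCob dX a (γ + γ') := by
  cases a with
  | zero => rw [show γ = 0 from h, show γ' = 0 from h', add_zero]; rfl
  | succ a =>
    obtain ⟨c, rfl⟩ := h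
    obtain ⟨c', rfl⟩ := h'
    exact ⟨c + c', by rw [LinearMap.add_comp]⟩

theorem IsCob.comp {N' : Type*} [AddCommGroup N'] [Module A N'] {a : ℕ} {γ : X a →ₗ[A] N}
    (h : IsCob dX a γ) (f : N →ₗ[A] N') : IsCob dX a (f ∘ₗ γ) := by
  cases a with
  | zero => rw [show γ = 0 from h, LinearMap.comp_zero]; rfl
  | succ a =>
    obtain ⟨c, rfl⟩ := h
    exact ⟨f ∘ₗ c, by rw [LinearMap.comp_assoc]⟩

theorem IsCob.smul {K : Type*} [Semiring K] [Module K N] [SMulCommClass A K N] {a : ℕ}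
    {γ : X a →ₗ[A] N} (h : IsCob dX a γ) (r : K) : IsCob dX a (r • γ) := by
  cases a with
  | zero => rw [show γ = 0 from h, smul_zero]; rfl
  | succ a =>
    obtain ⟨c, rfl⟩ := h
    exact ⟨r • c, by rw [LinearMap.smul_comp]⟩

theorem IsCob.comp_pcast {a b : ℕ} {γ : X b →ₗ[A] N} (h : IsCob dX b γ) (hab : a = b) :
    IsCob dX a (γ ∘ₗ pcast X hab) := by
  subst hab; exact h

/-- The coboundaries in `Hom(X•, N)` as a `K`-subspace. -/
def cobSub (K : Type*) [Field K] [Module K N] [SMulCommClass A K N]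
    (dX : ∀ l, X (l + 1) →ₗ[A] X l) (a : ℕ) : Submodule K (X a →ₗ[A] N) where
  carrier := {γ | IsCob dX a γ}
  add_mem' h h' := h.add h'
  zero_mem' := IsCob.zero a
  smul_mem' r _ h := h.smul r

end Cob

section Comparison

variable {A : Type*} [Ring A] {X : ℕ → Type*} [∀ l, AddCommGroup (X l)] [∀ l, Module A (X l)]
  {dX : ∀ l, X (l + 1) →ₗ[A] X l} {Y : ℕ → Type*} [∀ l, AddCommGroup (Y l)]
  [∀ l, Module A (Y l)] {dY : ∀ l, Y (l + 1) →ₗ[A] Y l}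
  {N : Type*} [AddCommGroup N] [Module A N] {ρ : Y 0 →ₗ[A] N}

theorem neg_one_pow_smul_smul {M : Type*} [AddCommGroup M] (k : ℕ) (x : M) :
    ((-1 : ℤ) ^ k) • ((-1 : ℤ) ^ k) • x = x := by
  rw [smul_smul, ← mul_pow]; simp

/-- Cocycles of `Hom(X•, N)` lift to chain maps from a complex of projectives into a
resolution of `N`. -/
theorem exists_chain_lift [∀ l, Module.Projective A (X l)] (hX : ∀ l, dX l ∘ₗ dX (l + 1) = 0)
    (hρ : Function.Surjective ρ) (hex0 : Function.Exact (dY 0) ρ)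
    (hex : ∀ l, Function.Exact (dY (l + 1)) (dY l)) (k : ℕ) (γ : X k →ₗ[A] N)
    (hγ : γ ∘ₗ dX k = 0) :
    ∃ g : ∀ m, X (k + m) →ₗ[A] Y m, ρ ∘ₗ g 0 = γ ∧
      ∀ m, g m ∘ₗ dX (k + m) = ((-1 : ℤ) ^ k) • (dY m ∘ₗ g (m + 1)) := by
  obtain ⟨g₀, hg₀⟩ := exists_lift_of_range_le γ ρ (fun x => hρ _)
  have hX' : ∀ l x, dX l (dX (l + 1) x) = 0 := fun l x => LinearMap.congr_fun (hX l) x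
  let T : ℕ → Type _ := fun m => {g : X (k + m) →ₗ[A] Y m // ∀ x, ∃ y, dY m y = g (dX (k + m) x)}
  have t₀ : ∀ x, ∃ y, dY 0 y = g₀ (dX k x) := fun x => (hex0 _).1 (by
    have h1 := LinearMap.congr_fun hg₀ (dX k x)
    have h2 := LinearMap.congr_fun hγ x
    simp only [LinearMap.comp_apply, LinearMap.zero_apply] at h1 h2
    rw [h1, h2])
  obtain ⟨f, hf0, hf⟩ := exists_dependent_seq (T := T) ⟨g₀, t₀⟩
    (fun m g g' => g.1 ∘ₗ dX (k + m) = ((-1 : ℤ) ^ k) • (dY m ∘ₗ g'.1)) (by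
      rintro m ⟨g, hg⟩
      obtain ⟨l, hl⟩ := exists_lift_of_range_le (g ∘ₗ dX (k + m)) (dY m) hg
      refine ⟨⟨((-1 : ℤ) ^ k) • l, fun x => (hex m _).1 ?_⟩, ?_⟩
      · have h1 := LinearMap.congr_fun hl (dX (k + (m + 1)) x)
        simp only [LinearMap.comp_apply] at h1
        rw [LinearMap.smul_apply, map_zsmul, h1, show dX (k + m) (dX (k + (m + 1)) x) = 0 from
          hX' _ _, map_zero, smul_zero]
      · change _ = _ • dY m ∘ₗ (_ • l)
        rw [LinearMap.comp_smul, neg_one_pow_smul_smul, hl])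
  refine ⟨fun m => (f m).1, ?_, hf⟩
  change ρ ∘ₗ (f 0).1 = γ
  rw [hf0]
  exact hg₀

/-- A chain map whose augmentation is a coboundary is null-homotopic. -/
theorem exists_homotopy [∀ l, Module.Projective A (X l)]
    (hρ : Function.Surjective ρ) (hex0 : Function.Exact (dY 0) ρ)
    (hex : ∀ l, Function.Exact (dY (l + 1)) (dY l)) (hX : ∀ l, dX l ∘ₗ dX (l + 1) = 0)
    (k : ℕ) (g : ∀ m, X (k + m) →ₗ[A] Y m)
    (hg : ∀ m, g m ∘ₗ dX (k + m) = ((-1 : ℤ) ^ k) • (dY m ∘ₗ g (m + 1)))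
    (hc : IsCob dX k (ρ ∘ₗ g 0)) :
    ∃ H : ∀ m, X (k + m) →ₗ[A] Y (m + 1), IsCob dX k (g 0 - dY 0 ∘ₗ H 0) ∧
      ∀ m, g (m + 1) = dY (m + 1) ∘ₗ H (m + 1) + ((-1 : ℤ) ^ k) • (H m ∘ₗ dX (k + m)) := by
  have hX' : ∀ l x, dX l (dX (l + 1) x) = 0 := fun l x => LinearMap.congr_fun (hX l) x
  have hg' : ∀ m x, g m (dX (k + m) x) = ((-1 : ℤ) ^ k) • dY m (g (m + 1) x) :=
    fun m x => LinearMap.congr_fun (hg m) x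
  obtain ⟨b, hb, hb'⟩ : ∃ b : X k →ₗ[A] Y 0, IsCob dX k b ∧ ρ ∘ₗ b = ρ ∘ₗ g 0 := by
    cases k with
    | zero => exact ⟨0, rfl, by rw [LinearMap.comp_zero]; exact hc.symm⟩
    | succ k =>
      obtain ⟨c, hc⟩ := hc
      obtain ⟨c', rfl⟩ := exists_lift_of_range_le c ρ (fun x => hρ _)
      exact ⟨c' ∘ₗ dX k, ⟨c', rfl⟩, hc.symm⟩
  have hbd : ∀ x, b (dX k x) = 0 := by
    intro x
    cases k with
    | zero => rw [show b = 0 from hb, LinearMap.zero_apply]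
    | succ k =>
      obtain ⟨c, rfl⟩ := hb
      rw [LinearMap.comp_apply, hX', map_zero]
  obtain ⟨H₀, hH₀⟩ := exists_lift_of_range_le (g 0 - b) (dY 0) (fun x => (hex0 _).1 (by
    have := LinearMap.congr_fun hb' x
    simp only [LinearMap.comp_apply] at this
    rw [LinearMap.sub_apply, map_sub, this, sub_self]))
  have hH₀' : ∀ x, dY 0 (H₀ x) = g 0 x - b x := fun x => LinearMap.congr_fun hH₀ x
  let T : ℕ → Type _ := fun m => {H : X (k + m) →ₗ[A] Y (m + 1) //
    ∀ x, dY m (H (dX (k + m) x)) = g m (dX (k + m) x)}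
  obtain ⟨f, hf0, hf⟩ := exists_dependent_seq (T := T)
    ⟨H₀, fun x => by rw [hH₀']; simpa using hbd x⟩
    (fun m H H' => dY (m + 1) ∘ₗ H'.1 = g (m + 1) - ((-1 : ℤ) ^ k) • (H.1 ∘ₗ dX (k + m))) (by
      rintro m ⟨H, hH⟩
      obtain ⟨l, hl⟩ := exists_lift_of_range_le
        (g (m + 1) - ((-1 : ℤ) ^ k) • (H ∘ₗ dX (k + m))) (dY (m + 1)) (fun x => (hex m _).1 (by
          simp only [LinearMap.sub_apply, LinearMap.smul_apply, LinearMap.comp_apply, map_sub,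
            map_zsmul, hH, hg']
          rw [neg_one_pow_smul_smul, sub_self]))
      refine ⟨⟨l, fun x => ?_⟩, hl⟩
      have h1 := LinearMap.congr_fun hl (dX (k + (m + 1)) x)
      simp only [LinearMap.comp_apply, LinearMap.sub_apply, LinearMap.smul_apply] at h1
      rw [h1, show dX (k + m) (dX (k + (m + 1)) x) = 0 from hX' _ _, map_zero, smul_zero,
        sub_zero])
  refine ⟨fun m => (f m).1, ?_, fun m => ?_⟩
  · change IsCob dX k (g 0 - dY 0 ∘ₗ (f 0).1)
    rw [hf0]
    change IsCob dX k (g 0 - dY 0 ∘ₗ H₀)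
    rw [hH₀, sub_sub_cancel]
    exact hb
  · rw [hf m, sub_add_cancel]

end Comparison

section Null

variable {A : Type*} [Ring A] {P : ℕ → Type*} [∀ l, AddCommGroup (P l)] [∀ l, Module A (P l)]
  {dP : ∀ l, P (l + 1) →ₗ[A] P l} {N : Type*} [AddCommGroup N] [Module A N] {ρ : P 0 →ₗ[A] N}

theorem IsNullMap.isCob (hρd : ρ ∘ₗ dP 0 = 0) {k : ℕ} {g : ExtDeg A P k}
    (h : IsNullMap P dP k g) : IsCob dP k (ρ ∘ₗ g 0) := by
  cases k with
  | zero =>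
    obtain ⟨h, h0, -⟩ := h
    change ρ ∘ₗ g 0 = 0
    rw [h0, ← LinearMap.comp_assoc, hρd, LinearMap.zero_comp]
  | succ k =>
    obtain ⟨h, h0⟩ := h
    refine ⟨-(((-1 : ℤ) ^ k) • (ρ ∘ₗ h 0)), ?_⟩
    ext x
    have h1 := LinearMap.congr_fun (h0 0) x
    have h2 : ∀ y, ρ (dP 0 y) = 0 := fun y => LinearMap.congr_fun hρd y
    simp only [LinearMap.sub_apply, LinearMap.comp_apply, LinearMap.smul_apply] at h1
    rw [LinearMap.comp_apply, h1, map_sub, h2, zero_sub, map_zsmul]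
    rfl

theorem isNullMap_of_isCob [∀ l, Module.Projective A (P l)]
    (hρ : Function.Surjective ρ) (hex0 : Function.Exact (dP 0) ρ)
    (hex : ∀ l, Function.Exact (dP (l + 1)) (dP l)) {k : ℕ} {g : ExtDeg A P k}
    (hg : IsChainMap P dP k g) (hc : IsCob dP k (ρ ∘ₗ g 0)) : IsNullMap P dP k g := by
  obtain ⟨H, hH0, hH⟩ := exists_homotopy hρ hex0 hex
    (fun l => LinearMap.ext fun x => (hex l).apply_apply_eq_zero x) k g hg hc
  cases k with
  | zero =>
    have hz : g 0 - dP 0 ∘ₗ H 0 = 0 := hH0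
    refine ⟨fun m => H m ∘ₗ pcast P (by omega), ?_, fun m => ?_⟩
    · rw [sub_eq_zero] at hz
      rw [hz]
      rfl
    · rw [hH m]
      ext x
      simp only [LinearMap.add_apply, LinearMap.comp_apply, pow_zero, one_smul,
        pcast_pcast, pcast_self]
      rw [d_pcast dP (a := 0 + m) (b := m) _ (by omega), pcast_pcast, pcast_self]
  | succ k =>
    obtain ⟨c, hc'⟩ := hH0
    refine ⟨fun m => Nat.rec (motive := fun m => P (k + m) →ₗ[A] P m)
      (-(((-1 : ℤ) ^ k) • c)) (fun m _ => H m ∘ₗ pcast P (by omega)) m, fun m => ?_⟩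
    cases m with
    | zero =>
      rw [sub_eq_iff_eq_add] at hc'
      rw [hc']
      ext x
      change c (dP k x) + dP 0 (H 0 x) =
        dP 0 (H 0 x) - ((-1 : ℤ) ^ k) • (-(((-1 : ℤ) ^ k) • c)) (dP k x)
      rw [LinearMap.neg_apply, LinearMap.smul_apply, smul_neg, neg_one_pow_smul_smul,
        sub_neg_eq_add, add_comm]
    | succ m =>
      rw [hH m]
      ext x
      simp only [LinearMap.add_apply, LinearMap.comp_apply, LinearMap.smul_apply,
        LinearMap.sub_apply, pcast_pcast, pcast_self]
      rw [← d_pcast dP (a := k + (m + 1)) (b := (k + 1) + m) (by omega) (by omega), pcast_pcast,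
        pcast_self, pow_succ]
      simp [sub_eq_add_neg]

end Null

theorem InjCoresolution.ExtVanish.finsupp {A : Type u} [Ring A] {L : Type u} [AddCommGroup L]
    [Module A L] {R : InjCoresolution A L} {M : Type u} [AddCommGroup M] [Module A M]
    {t : ℕ} (h : R.ExtVanish (t + 1) M) (κ : Type u) : R.ExtVanish (t + 1) (κ →₀ M) := by
  intro f hf
  have h' : ∀ x, ∃ g : M →ₗ[A] R.I t, R.d t ∘ₗ g = f ∘ₗ Finsupp.lsingle x := fun x =>
    h _ (by rw [← LinearMap.comp_assoc, hf, LinearMap.zero_comp])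
  choose g hg using h'
  refine ⟨Finsupp.lsum ℕ g, Finsupp.lhom_ext' fun x => ?_⟩
  rw [← hg]
  ext y
  simp

/-- The `A`-module `M ^ m` obtained from an `E`-module `M` along a ring homomorphism from `A` to
the ring of `m × m` matrices over `E`. -/
def MatMod {A E : Type*} [Ring A] [Ring E] {m : ℕ} (_R : A →+* Matrix (Fin m) (Fin m) E)
    (M : Type*) := Fin m → M

namespace MatMod

section

variable {A E : Type*} [Ring A] [Ring E] {m : ℕ} (R : A →+* Matrix (Fin m) (Fin m) E)
  {M N S : Type*} [AddCommGroup M] [Module E M] [AddCommGroup N] [Module E N]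
  [AddCommGroup S] [Module E S]

instance : AddCommGroup (MatMod R M) := inferInstanceAs (AddCommGroup (Fin m → M))

open Matrix.Module in
instance : Module A (MatMod R M) := Module.compHom (Fin m → M) R

/-- The element of `M ^ m` with given coordinates. -/
def of (v : Fin m → M) : MatMod R M := v

/-- The coordinates of an element of `M ^ m`. -/
def coord (v : MatMod R M) (u : Fin m) : M := v u

omit [AddCommGroup M] [Module E M] in
variable {R} in
theorem ext {v w : MatMod R M} (h : ∀ u, coord R v u = coord R w u) : v = w := funext h

omit [AddCommGroup M] [Module E M] in
@[simp]
theorem coord_of (v : Fin m → M) (u : Fin m) : coord R (of R v) u = v u := rfl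

@[simp]
theorem coord_smul (a : A) (v : MatMod R M) (u : Fin m) :
    coord R (a • v) u = ∑ s, R a u s • coord R v s := rfl

omit [Module E M] in
@[simp]
theorem coord_add (v w : MatMod R M) (u : Fin m) :
    coord R (v + w) u = coord R v u + coord R w u := rfl

omit [Module E M] in
@[simp]
theorem coord_zero (u : Fin m) : coord R (0 : MatMod R M) u = 0 := rfl

/-- The functoriality of `MatMod`. -/
def map (f : M →ₗ[E] N) : MatMod R M →ₗ[A] MatMod R N where
  toFun v := of R fun u => f (coord R v u)
  map_add' v w := ext fun u => map_add f (coord R v u) (coord R w u)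
  map_smul' a v := ext fun u => by
    simp only [coord_of, coord_smul, map_sum, map_smul, RingHom.id_apply]

@[simp]
theorem coord_map (f : M →ₗ[E] N) (v : MatMod R M) (u : Fin m) :
    coord R (map R f v) u = f (coord R v u) := rfl

theorem map_comp (g : N →ₗ[E] S) (f : M →ₗ[E] N) : map R (g ∘ₗ f) = map R g ∘ₗ map R f := rfl

theorem map_id : map R (LinearMap.id : M →ₗ[E] M) = LinearMap.id := rfl

theorem map_surjective {f : M →ₗ[E] N} (hf : Function.Surjective f) :
    Function.Surjective (map R f) := by
  intro v
  choose w hw using fun u => hf (coord R v u)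
  exact ⟨of R w, ext hw⟩

theorem map_exact {f : M →ₗ[E] N} {g : N →ₗ[E] S} (h : Function.Exact f g) :
    Function.Exact (map R f) (map R g) := by
  intro v
  constructor
  · intro hv
    choose w hw using fun u => (h (coord R v u)).1 (congrArg (fun v => coord R v u) hv)
    exact ⟨of R w, ext hw⟩
  · rintro ⟨w, rfl⟩
    exact ext fun u => h.apply_apply_eq_zero (coord R w u)

/-- The vector with a single nonzero coordinate. -/
def single (s : Fin m) (x : M) : MatMod R M := of R (Pi.single s x)

omit [Module E M] in
theorem coord_single (s : Fin m) (x : M) (u : Fin m) :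
    coord R (single R s x) u = if u = s then x else 0 := by
  simp [single, Pi.single_apply]

omit [Module E M] in
theorem eq_sum_single (v : MatMod R M) : v = ∑ s, single R s (coord R v s) :=
  (Finset.univ_sum_single (M := fun _ => M) v).symm

/-- Linear maps out of `M ^ m` agree when they agree on the coordinate vectors. -/
theorem hom_ext {T : Type*} [AddCommGroup T] [Module A T] {f g : MatMod R M →ₗ[A] T}
    (h : ∀ s x, f (single R s x) = g (single R s x)) : f = g := by
  ext v
  rw [eq_sum_single R v, map_sum, map_sum]
  exact Finset.sum_congr rfl fun s _ => h s _

theorem map_single (f : M →ₗ[E] N) (s : Fin m) (x : M) :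
    map R f (single R s x) = single R s (f x) := by
  refine ext fun u => ?_
  rw [coord_map, coord_single, coord_single]
  split_ifs <;> simp

theorem exists_map_eq (hm : 0 < m)
    (hfull : ∀ τ : MatMod R E →ₗ[A] MatMod R S, ∃ σ : E →ₗ[E] S, map R σ = τ)
    (τ : MatMod R M →ₗ[A] MatMod R S) : ∃ σ : M →ₗ[E] S, map R σ = τ := by
  choose σ hσ using fun x : M => hfull (τ ∘ₗ map R (LinearMap.toSpanSingleton E M x))
  have key : ∀ x (v : Fin m → E) u, coord R (τ (of R fun s => v s • x)) u = v u • σ x 1 := by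
    intro x v u
    have := congrArg (fun w => coord R w u) (LinearMap.congr_fun (hσ x) (of R v))
    rw [coord_map, coord_of] at this
    rw [← map_smul, smul_eq_mul, mul_one, this]
    rfl
  have key1 : ∀ x u, coord R (τ (of R fun _ => x)) u = σ x 1 := by
    intro x u
    simpa using key x (fun _ => 1) u
  refine ⟨{ toFun := fun x => σ x 1, map_add' := ?_, map_smul' := ?_ }, ?_⟩
  · intro x y
    rw [← key1 x ⟨0, hm⟩, ← key1 y ⟨0, hm⟩, ← key1 _ ⟨0, hm⟩, ← coord_add, ← _root_.map_add]
    rfl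
  · intro r x
    rw [← key1 _ ⟨0, hm⟩, key x (fun _ => r)]
    rfl
  · refine hom_ext R fun s x => ?_
    rw [map_single]
    refine ext fun u => ?_
    have h1 := key x (fun t => if t = s then 1 else 0) u
    have h2 : (of R fun t => (if t = s then (1 : E) else 0) • x) = single R s x := by
      refine ext fun t => ?_
      rw [coord_single, coord_of, ite_smul, one_smul, zero_smul]
    rw [h2] at h1
    rw [h1, coord_single, ite_smul, one_smul, zero_smul]
    rfl

end

section

variable {A E : Type u} [Ring A] [Ring E] {m : ℕ} {R : A →+* Matrix (Fin m) (Fin m) E}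
  {L : Type u} [AddCommGroup L] [Module A L] {C : InjCoresolution A L}

/-- `MatMod` commutes with direct sums. -/
def toFinsupp (R : A →+* Matrix (Fin m) (Fin m) E) (κ : Type u) :
    MatMod R (κ →₀ E) →ₗ[A] (κ →₀ MatMod R E) where
  toFun v := Finsupp.ofSupportFinite (fun x => of R fun s => coord R v s x) (by
    refine Set.Finite.subset (Set.finite_iUnion fun s => (coord R v s).hasFiniteSupport)
      fun x hx => ?_
    by_contra h
    simp only [Set.mem_iUnion, not_exists, Function.mem_support, not_not] at h
    exact hx (ext h))
  map_add' v w := by ext x; rfl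
  map_smul' a v := by
    ext x
    refine ext fun u => ?_
    change (∑ s, R a u s • coord R v s) x = ∑ s, R a u s • coord R v s x
    simp

theorem toFinsupp_apply (κ : Type u) (v : MatMod R (κ →₀ E)) (x : κ) :
    toFinsupp R κ v x = of R fun s => coord R v s x := rfl

theorem toFinsupp_single (κ : Type u) (s : Fin m) (x : κ) (r : E) :
    toFinsupp R κ (single R s (Finsupp.single x r)) = Finsupp.single x (single R s r) := by
  classical
  ext y
  refine ext fun u => ?_
  rw [toFinsupp_apply, coord_of, coord_single, Finsupp.single_apply]
  split_ifs with h h' h' <;> simp [coord_single, h, h']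

theorem acyclic (h : C.Acyclic (MatMod R E)) (M : Type u) [AddCommGroup M] [Module E M]
    [hM : Module.Projective E M] : C.Acyclic (MatMod R M) := by
  obtain ⟨i, hi⟩ := Module.projective_def'.1 hM
  intro t
  have h1 : C.ExtVanish (t + 1) (MatMod R (M →₀ E)) := by
    refine ((h t).finsupp M).of_retract (toFinsupp R M)
      (Finsupp.lsum ℕ fun x => map R (Finsupp.lsingle x)) (hom_ext R fun s v => ?_)
    induction v using Finsupp.induction_linear with
    | zero => rw [show single R s (0 : M →₀ E) = 0 from by simp [single]; rfl, _root_.map_zero,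
        _root_.map_zero]
    | add f g hf hg =>
      rw [show single R s (f + g) = single R s f + single R s g from
        Pi.single_add (f := fun _ : Fin m => M →₀ E) s f g, _root_.map_add, _root_.map_add, hf, hg]
    | single x r =>
      rw [LinearMap.comp_apply, toFinsupp_single, LinearMap.id_apply, Finsupp.lsum_single,
        map_single, Finsupp.lsingle_apply]
  refine h1.of_retract (map R i) (map R (Finsupp.linearCombination E id)) ?_
  rw [← map_comp, hi, map_id]

end

end MatMod

section AcyclicComplex

variable {A : Type u} [Ring A] {L : Type u} [AddCommGroup L] [Module A L]
  {R : InjCoresolution A L} {C : ℕ → Type u} [∀ l, AddCommGroup (C l)] [∀ l, Module A (C l)]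
  {d : ∀ l, C (l + 1) →ₗ[A] C l}

theorem InjCoresolution.Acyclic.range_of_exact (hC : ∀ l, R.Acyclic (C l))
    (hd : Function.Surjective (d 0)) (hex : ∀ l, Function.Exact (d (l + 1)) (d l)) (l : ℕ) :
    R.Acyclic (C l ⧸ LinearMap.range (d l)) := by
  induction l with
  | zero =>
    have : Subsingleton (C 0 ⧸ LinearMap.range (d 0)) := by
      rw [Submodule.Quotient.subsingleton_iff, LinearMap.range_eq_top]
      exact hd
    exact fun t => extVanish_of_subsingleton (t + 1)
  | succ l ih =>
    have h : R.Acyclic (LinearMap.range (d l)) := by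
      refine InjCoresolution.Acyclic.of_ker (i := (LinearMap.range (d l)).subtype)
        (p := (LinearMap.range (d l)).mkQ) (Submodule.subtype_injective _)
        (Submodule.mkQ_surjective _) ?_ (hC l) ih
      exact LinearMap.exact_subtype_mkQ _
    obtain ⟨e, -⟩ := exists_linearEquiv_of_same_ker (d l).rangeRestrict
      (d l).surjective_rangeRestrict (LinearMap.range (d (l + 1))).mkQ
      (Submodule.mkQ_surjective _) (fun x => by
        rw [Submodule.mkQ_apply, Submodule.Quotient.mk_eq_zero, LinearMap.mem_range]
        refine Iff.trans ?_ (hex l x)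
        rw [← Subtype.coe_inj]
        rfl)
    exact fun t => (h t).of_equiv e

theorem isCob_of_acyclic (hC : ∀ l, R.Acyclic (C l)) (hd : Function.Surjective (d 0))
    (hex : ∀ l, Function.Exact (d (l + 1)) (d l)) {l : ℕ} (τ : C l →ₗ[A] L)
    (hτ : τ ∘ₗ d l = 0) : IsCob d l τ := by
  have hτ' : ∀ x, τ (d l x) = 0 := fun x => LinearMap.congr_fun hτ x
  cases l with
  | zero =>
    refine LinearMap.ext fun y => ?_
    obtain ⟨x, rfl⟩ := hd y
    exact hτ' x
  | succ l =>
    obtain ⟨f, hf⟩ := exists_factor_of_ker_le (d l).rangeRestrict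
      (d l).surjective_rangeRestrict τ (fun x hx => by
        obtain ⟨y, rfl⟩ := (hex l x).1 (congrArg Subtype.val hx)
        exact hτ' y)
    obtain ⟨c, hc⟩ := InjCoresolution.Acyclic.exists_extension
      (i := (LinearMap.range (d l)).subtype) (p := (LinearMap.range (d l)).mkQ)
      (Submodule.subtype_injective _) (Submodule.mkQ_surjective _)
      (LinearMap.exact_subtype_mkQ _)
      (InjCoresolution.Acyclic.range_of_exact hC hd hex l) f
    exact ⟨c, by rw [← hf, ← hc]; rfl⟩

end AcyclicComplex

section Cone

/-- The terms of the mapping cone of a chain map `P• → Q•`. -/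
def ConeX (Q P : ℕ → Type u) : ℕ → Type u
  | 0 => Q 0
  | l + 1 => Q (l + 1) × P l

variable {A : Type u} [Ring A] {Q P : ℕ → Type u} [∀ l, AddCommGroup (Q l)]
  [∀ l, Module A (Q l)] [∀ l, AddCommGroup (P l)] [∀ l, Module A (P l)]

instance ConeX.addCommGroup : ∀ l, AddCommGroup (ConeX Q P l)
  | 0 => inferInstanceAs (AddCommGroup (Q 0))
  | l + 1 => inferInstanceAs (AddCommGroup (Q (l + 1) × P l))

instance ConeX.module : ∀ l, Module A (ConeX Q P l)
  | 0 => inferInstanceAs (Module A (Q 0))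
  | l + 1 => inferInstanceAs (Module A (Q (l + 1) × P l))

/-- The inclusion of the target of a chain map into the mapping cone. -/
def ConeX.inl : ∀ l, Q l →ₗ[A] ConeX Q P l
  | 0 => (LinearMap.id : Q 0 →ₗ[A] Q 0)
  | l + 1 => LinearMap.inl A (Q (l + 1)) (P l)

/-- The degreewise inclusion of the source of a chain map into the mapping cone. -/
def ConeX.inr (l : ℕ) : P l →ₗ[A] ConeX Q P (l + 1) := LinearMap.inr A (Q (l + 1)) (P l)

/-- The differential of the mapping cone. -/
def ConeX.d (dQ : ∀ l, Q (l + 1) →ₗ[A] Q l) (dP : ∀ l, P (l + 1) →ₗ[A] P l)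
    (q : ∀ l, P l →ₗ[A] Q l) : ∀ l, ConeX Q P (l + 1) →ₗ[A] ConeX Q P l
  | 0 => (LinearMap.coprod (dQ 0) (q 0) : Q 1 × P 0 →ₗ[A] Q 0)
  | l + 1 => (LinearMap.prod (LinearMap.coprod (dQ (l + 1)) (q (l + 1)))
      (-(dP l ∘ₗ LinearMap.snd A (Q (l + 2)) (P (l + 1)))) :
        Q (l + 2) × P (l + 1) →ₗ[A] Q (l + 1) × P l)

variable {dQ : ∀ l, Q (l + 1) →ₗ[A] Q l} {dP : ∀ l, P (l + 1) →ₗ[A] P l}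
  {q : ∀ l, P l →ₗ[A] Q l} {L : Type u} [AddCommGroup L] [Module A L]
  {π : P 0 →ₗ[A] L} {ρ : Q 0 →ₗ[A] L} {R : InjCoresolution A L}

theorem ConeX.acyclic (hP : ∀ l, R.Acyclic (P l)) (hQ : ∀ l, R.Acyclic (Q l)) :
    ∀ l, R.Acyclic (ConeX Q P l)
  | 0 => hQ 0
  | l + 1 => InjCoresolution.Acyclic.prod (hQ (l + 1)) (hP l)

theorem ConeX.d_inl (l : ℕ) (y : Q (l + 1)) :
    ConeX.d dQ dP q l (ConeX.inl (A := A) (l + 1) y) = ConeX.inl (A := A) l (dQ l y) := by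
  cases l with
  | zero =>
    change dQ 0 y + q 0 0 = dQ 0 y
    rw [map_zero, add_zero]
  | succ l =>
    change ((dQ (l + 1) y + q (l + 1) 0, -dP l 0) : Q (l + 1) × P l) = (dQ (l + 1) y, 0)
    rw [map_zero, map_zero, neg_zero, add_zero]

theorem ConeX.d_inr_zero (x : P 0) :
    ConeX.d dQ dP q 0 (ConeX.inr (A := A) 0 x) = ConeX.inl (A := A) 0 (q 0 x) := by
  change dQ 0 0 + q 0 x = q 0 x
  rw [map_zero, zero_add]

theorem ConeX.d_inr_succ (l : ℕ) (x : P (l + 1)) :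
    ConeX.d dQ dP q (l + 1) (ConeX.inr (A := A) (l + 1) x) =
      ConeX.inl (A := A) (l + 1) (q (l + 1) x) - ConeX.inr (A := A) l (dP l x) := by
  change ((dQ (l + 1) 0 + q (l + 1) x, -dP l x) : Q (l + 1) × P l) =
    (q (l + 1) x - 0, 0 - dP l x)
  rw [map_zero, zero_add, sub_zero, zero_sub]

theorem ConeX.d_surjective (hπ : Function.Surjective π) (hQ0 : Function.Exact (dQ 0) ρ)
    (hq0 : ρ ∘ₗ q 0 = π) : Function.Surjective (ConeX.d dQ dP q 0) := by
  intro (z : Q 0)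
  obtain ⟨x, hx⟩ := hπ (ρ z)
  obtain ⟨y, hy⟩ := (hQ0 (z - q 0 x)).1 (by
    rw [map_sub, ← hx, ← hq0, LinearMap.comp_apply, sub_self])
  refine ⟨((y, x) : Q 1 × P 0), ?_⟩
  change dQ 0 y + q 0 x = z
  rw [hy, sub_add_cancel]

theorem ConeX.exact (hP0 : Function.Exact (dP 0) π)
    (hP : ∀ l, Function.Exact (dP (l + 1)) (dP l)) (hQ0 : Function.Exact (dQ 0) ρ)
    (hQ : ∀ l, Function.Exact (dQ (l + 1)) (dQ l)) (hq0 : ρ ∘ₗ q 0 = π)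
    (hq : ∀ l, q l ∘ₗ dP l = dQ l ∘ₗ q (l + 1)) (l : ℕ) :
    Function.Exact (ConeX.d dQ dP q (l + 1)) (ConeX.d dQ dP q l) := by
  have hq' : ∀ l x, q l (dP l x) = dQ l (q (l + 1) x) := fun l x => LinearMap.congr_fun (hq l) x
  have hq0' : ∀ x, ρ (q 0 x) = π x := fun x => LinearMap.congr_fun hq0 x
  have hdd : ∀ l x, dQ l (dQ (l + 1) x) = 0 := fun l => (hQ l).apply_apply_eq_zero
  rintro ⟨y, x⟩
  have key : ∀ x', dP l x' = x → dQ l y + q l x = 0 →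
      ∃ w, ConeX.d dQ dP q (l + 1) w = ((y, x) : Q (l + 1) × P l) := by
    rintro x' rfl h
    obtain ⟨y', hy'⟩ := (hQ l (y + q (l + 1) x')).1 (by rw [map_add, ← hq', h])
    refine ⟨((y', -x') : Q (l + 2) × P (l + 1)), ?_⟩
    change ((dQ (l + 1) y' + q (l + 1) (-x'), -dP l (-x')) : Q (l + 1) × P l) = _
    rw [hy', map_neg, map_neg, neg_neg, add_neg_cancel_right]
  cases l with
  | zero =>
    constructor
    · intro (h : dQ 0 y + q 0 x = 0)
      have h' := congrArg ρ h
      rw [map_add, hQ0.apply_apply_eq_zero, zero_add, hq0', map_zero] at h'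
      obtain ⟨x', hx'⟩ := (hP0 x).1 h'
      exact key x' hx' h
    · rintro ⟨⟨y', x'⟩, h⟩
      rw [← h]
      change dQ 0 (dQ 1 y' + q 1 x') + q 0 (-dP 0 x') = 0
      rw [map_add, hdd, map_neg, hq']; abel
  | succ l =>
    constructor
    · intro h
      have h1 : dQ (l + 1) y + q (l + 1) x = 0 := congrArg Prod.fst h
      have h2 : -dP l x = 0 := congrArg Prod.snd h
      obtain ⟨x', hx'⟩ := (hP l x).1 (neg_eq_zero.1 h2)
      exact key x' hx' h1
    · rintro ⟨⟨y', x'⟩, h⟩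
      rw [← h]
      change ((dQ (l + 1) (dQ (l + 2) y' + q (l + 2) x') + q (l + 1) (-dP (l + 1) x'),
        -dP l (-dP (l + 1) x')) : Q (l + 1) × P l) = 0
      rw [map_add, hdd, map_neg, hq', map_neg, (hP l).apply_apply_eq_zero]
      ext <;> simp

variable (hPa : ∀ l, R.Acyclic (P l)) (hQa : ∀ l, R.Acyclic (Q l))
  (hπ : Function.Surjective π) (hP0 : Function.Exact (dP 0) π)
  (hP : ∀ l, Function.Exact (dP (l + 1)) (dP l)) (hQ0 : Function.Exact (dQ 0) ρ)
  (hQ : ∀ l, Function.Exact (dQ (l + 1)) (dQ l)) (hq0 : ρ ∘ₗ q 0 = π)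
  (hq : ∀ l, q l ∘ₗ dP l = dQ l ∘ₗ q (l + 1))

include hPa hQa hπ hP0 hP hQ0 hQ hq0 hq

/-- A comparison map of acyclic resolutions is injective on cohomology of `Hom(-, L)`. -/
theorem isCob_of_isCob_comp {k : ℕ} (τ : Q k →ₗ[A] L) (hτ : τ ∘ₗ dQ k = 0)
    (h : IsCob dP k (τ ∘ₗ q k)) : IsCob dQ k τ := by
  have hC := fun l => isCob_of_acyclic (ConeX.acyclic hPa hQa)
    (ConeX.d_surjective (dP := dP) hπ hQ0 hq0) (ConeX.exact hP0 hP hQ0 hQ hq0 hq) (l := l)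
  have hτ' : ∀ y, τ (dQ k y) = 0 := fun y => LinearMap.congr_fun hτ y
  cases k with
  | zero =>
    have h0 : ∀ x, τ (q 0 x) = 0 := fun x => LinearMap.congr_fun (show τ ∘ₗ q 0 = 0 from h) x
    refine hC 0 τ (LinearMap.ext ?_)
    rintro ⟨y, x⟩
    change τ (dQ 0 y + q 0 x) = 0
    rw [map_add, hτ', h0, add_zero]
  | succ l =>
    obtain ⟨c, hc⟩ := h
    have hc' : ∀ x, τ (q (l + 1) x) = c (dP l x) := fun x => LinearMap.congr_fun hc x
    obtain ⟨s, hs⟩ := hC (l + 1) (LinearMap.coprod τ c : Q (l + 1) × P l →ₗ[A] L)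
      (LinearMap.ext (by
        rintro ⟨y, x⟩
        change τ (dQ (l + 1) y + q (l + 1) x) + c (-dP l x) = 0
        rw [map_add, hτ', hc', map_neg, zero_add, add_neg_cancel]))
    refine ⟨s ∘ₗ ConeX.inl l, LinearMap.ext fun y => ?_⟩
    have h1 := (LinearMap.congr_fun hs (ConeX.inl (A := A) (l + 1) y)).trans
      (congrArg s (ConeX.d_inl l y))
    refine Eq.trans ?_ h1
    change τ y = τ y + c 0
    rw [map_zero, add_zero]

/-- A comparison map of acyclic resolutions is surjective on cohomology of `Hom(-, L)`. -/
theorem exists_isCob_sub_comp {k : ℕ} (γ : P k →ₗ[A] L) (hγ : γ ∘ₗ dP k = 0) :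
    ∃ τ : Q k →ₗ[A] L, τ ∘ₗ dQ k = 0 ∧ IsCob dP k (γ - τ ∘ₗ q k) := by
  have hC := fun l => isCob_of_acyclic (ConeX.acyclic hPa hQa)
    (ConeX.d_surjective (dP := dP) hπ hQ0 hq0) (ConeX.exact hP0 hP hQ0 hQ hq0 hq) (l := l)
  have hγ' : ∀ x, γ (dP k x) = 0 := fun x => LinearMap.congr_fun hγ x
  obtain ⟨s, hs⟩ := hC (k + 1) (γ ∘ₗ LinearMap.snd A _ _ : Q (k + 1) × P k →ₗ[A] L)
    (LinearMap.ext (by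
      rintro ⟨y, x⟩
      change γ (-dP k x) = 0
      rw [map_neg, hγ', neg_zero]))
  refine ⟨s ∘ₗ ConeX.inl k, LinearMap.ext fun y => ?_, ?_⟩
  · exact ((LinearMap.congr_fun hs (ConeX.inl (A := A) (k + 1) y)).trans
      (congrArg s (ConeX.d_inl k y))).symm.trans (map_zero γ)
  · have h1 : ∀ x, γ x = s (ConeX.d dQ dP q k (ConeX.inr (A := A) k x)) := fun x =>
      LinearMap.congr_fun hs (ConeX.inr (A := A) k x)
    cases k with
    | zero =>
      refine LinearMap.ext fun x => ?_
      rw [LinearMap.sub_apply, h1, ConeX.d_inr_zero]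
      exact sub_self _
    | succ l =>
      refine ⟨-(s ∘ₗ ConeX.inr l), LinearMap.ext fun x => ?_⟩
      rw [LinearMap.sub_apply, h1, ConeX.d_inr_succ, map_sub]
      simp

end Cone

/-- Two linear maps to the same space with the same image induce an isomorphism between the
quotients by their kernels. -/
theorem exists_quotient_equiv {K U V H : Type*} [Field K] [AddCommGroup U] [Module K U]
    [AddCommGroup V] [Module K V] [AddCommGroup H] [Module K H] (α : U →ₗ[K] H)
    (β : V →ₗ[K] H) (N : Submodule K U) (N' : Submodule K V) (hN : LinearMap.ker α = N)
    (hN' : LinearMap.ker β = N') (h : LinearMap.range α = LinearMap.range β) :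
    ∃ φ : (U ⧸ N) ≃ₗ[K] (V ⧸ N'), ∀ x y,
      φ (Submodule.Quotient.mk x) = Submodule.Quotient.mk y ↔ α x = β y := by
  subst hN; subst hN'
  refine ⟨α.quotKerEquivRange.trans ((LinearEquiv.ofEq _ _ h).trans β.quotKerEquivRange.symm),
    fun x y => ?_⟩
  rw [LinearEquiv.trans_apply, LinearEquiv.trans_apply, LinearEquiv.symm_apply_eq,
    ← Subtype.coe_inj]
  rfl

section ChainSub

variable {A : Type*} [Ring A] {P : ℕ → Type*} [∀ l, AddCommGroup (P l)] [∀ l, Module A (P l)]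
  {dP : ∀ l, P (l + 1) →ₗ[A] P l} {K : Type*} [Field K] [Algebra K A]
  [∀ l, Module K (P l)] [∀ l, IsScalarTower K A (P l)] [∀ l, SMulCommClass A K (P l)]

theorem isChainMap_of_mem_chainSub {k : ℕ} {g : ExtDeg A P k} (hg : g ∈ chainSub P dP K k) :
    IsChainMap P dP k g := by
  induction hg using Submodule.span_induction with
  | mem g hg => exact hg
  | zero => intro m; simp
  | add f g _ _ hf hg =>
    intro m
    rw [Pi.add_apply, Pi.add_apply, LinearMap.add_comp, LinearMap.comp_add, smul_add, hf, hg]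
  | smul c g _ hg =>
    intro m
    rw [Pi.smul_apply, Pi.smul_apply, LinearMap.smul_comp, hg, LinearMap.comp_smul, smul_comm]

theorem isCob_comp_of_isChainMap {N : Type*} [AddCommGroup N] [Module A N] {k : ℕ}
    {y : ExtDeg A P k} (hy : IsChainMap P dP k y) {j : ℕ} {γ : P j →ₗ[A] N}
    (hγ : IsCob dP j γ) : IsCob dP (k + j) (γ ∘ₗ y j) := by
  cases j with
  | zero =>
    rw [show γ = 0 from hγ, LinearMap.zero_comp]
    exact IsCob.zero _
  | succ j =>
    obtain ⟨c, rfl⟩ := hγ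
    refine ⟨((-1 : ℤ) ^ k) • (c ∘ₗ y j), LinearMap.ext fun x => ?_⟩
    change c (dP j (y (j + 1) x)) = ((-1 : ℤ) ^ k) • c (y j (dP (k + j) x))
    rw [show y j (dP (k + j) x) = ((-1 : ℤ) ^ k) • dP j (y (j + 1) x) from
      LinearMap.congr_fun (hy j) x, map_zsmul, neg_one_pow_smul_smul]

end ChainSub

section Comparison

variable {K : Type*} [Field K] {A E : Type u} [Ring A] [Ring E] [Algebra K A] [Algebra K E]
  {m : ℕ} {R : A →+* Matrix (Fin m) (Fin m) E}
  {L : Type u} [AddCommGroup L] [Module A L] [Module K L] [IsScalarTower K A L]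
  [SMulCommClass A K L] {S : Type u} [AddCommGroup S] [Module E S]
  (ι : MatMod R S ≃ₗ[A] L)

/-- The map `Hom(M, S) → Hom(M ^ m, L)` induced by an isomorphism of `S ^ m` with `L`. -/
def theta {M : Type*} [AddCommGroup M] [Module E M] (σ : M →ₗ[E] S) : MatMod R M →ₗ[A] L :=
  ι.toLinearMap ∘ₗ MatMod.map R σ

theorem theta_comp {M N : Type*} [AddCommGroup M] [Module E M] [AddCommGroup N] [Module E N]
    (σ : N →ₗ[E] S) (f : M →ₗ[E] N) : theta ι (σ ∘ₗ f) = theta ι σ ∘ₗ MatMod.map R f := rfl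

theorem theta_injective (hm : 0 < m) {M : Type*} [AddCommGroup M] [Module E M]
    {σ σ' : M →ₗ[E] S} (h : theta ι σ = theta ι σ') : σ = σ' := by
  ext x
  have h1 := ι.injective (LinearMap.congr_fun h (MatMod.of R fun _ => x))
  exact congrArg (fun v => MatMod.coord R v ⟨0, hm⟩) h1

theorem theta_zero {M : Type*} [AddCommGroup M] [Module E M] :
    theta ι (0 : M →ₗ[E] S) = 0 := by
  ext v
  exact map_zero ι

theorem exists_theta_eq (hm : 0 < m)
    (hfull : ∀ τ : MatMod R E →ₗ[A] MatMod R S, ∃ σ : E →ₗ[E] S, MatMod.map R σ = τ)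
    {M : Type*} [AddCommGroup M] [Module E M] (τ : MatMod R M →ₗ[A] L) :
    ∃ σ : M →ₗ[E] S, theta ι σ = τ := by
  obtain ⟨σ, hσ⟩ := MatMod.exists_map_eq R hm hfull (ι.symm.toLinearMap ∘ₗ τ)
  refine ⟨σ, ?_⟩
  rw [theta, hσ]
  ext v
  simp

variable {P' : ℕ → Type u} [∀ l, AddCommGroup (P' l)] [∀ l, Module E (P' l)]
  {dP' : ∀ l, P' (l + 1) →ₗ[E] P' l}

theorem isCob_theta {k : ℕ} {σ : P' k →ₗ[E] S} (h : IsCob dP' k σ) :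
    IsCob (X := fun l => MatMod R (P' l)) (fun l => MatMod.map R (dP' l)) k (theta ι σ) := by
  cases k with
  | zero =>
    rw [show σ = 0 from h, theta_zero]
    rfl
  | succ k =>
    obtain ⟨c, rfl⟩ := h
    exact ⟨theta ι c, rfl⟩

theorem isCob_of_theta (hm : 0 < m)
    (hfull : ∀ τ : MatMod R E →ₗ[A] MatMod R S, ∃ σ : E →ₗ[E] S, MatMod.map R σ = τ)
    {k : ℕ} {σ : P' k →ₗ[E] S}
    (h : IsCob (X := fun l => MatMod R (P' l)) (fun l => MatMod.map R (dP' l)) k (theta ι σ)) :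
    IsCob dP' k σ := by
  cases k with
  | zero => exact theta_injective ι hm ((show theta ι σ = 0 from h).trans (theta_zero ι).symm)
  | succ k =>
    obtain ⟨c, hc⟩ := h
    obtain ⟨c', rfl⟩ := exists_theta_eq ι hm hfull c
    exact ⟨c', theta_injective ι hm hc⟩

variable {P : ℕ → Type u} [∀ l, AddCommGroup (P l)] [∀ l, Module A (P l)]
  {dP : ∀ l, P (l + 1) →ₗ[A] P l}

theorem isCob_comp_chain {q : ∀ l, P l →ₗ[A] MatMod R (P' l)}
    (hq : ∀ l, q l ∘ₗ dP l = MatMod.map R (dP' l) ∘ₗ q (l + 1)) {N : Type*} [AddCommGroup N]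
    [Module A N] {k : ℕ} {τ : MatMod R (P' k) →ₗ[A] N}
    (h : IsCob (X := fun l => MatMod R (P' l)) (fun l => MatMod.map R (dP' l)) k τ) :
    IsCob dP k (τ ∘ₗ q k) := by
  cases k with
  | zero =>
    rw [show τ = 0 from h, LinearMap.zero_comp]
    rfl
  | succ k =>
    obtain ⟨c, rfl⟩ := h
    exact ⟨c ∘ₗ q k, by rw [LinearMap.comp_assoc, ← hq k, LinearMap.comp_assoc]⟩

theorem map_pcast_comp (q : ∀ l, P l →ₗ[A] MatMod R (P' l)) {a b : ℕ} (h : a = b) :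
    MatMod.map R (pcast P' h) ∘ₗ q a = q b ∘ₗ pcast P h := by
  subst h; rfl

/-- Comparison of Yoneda products: compatibility of classes is multiplicative. -/
theorem isCob_extComp [∀ l, Module.Projective A (P l)]
    {π : P 0 →ₗ[A] L} (hex : ∀ l, Function.Exact (dP (l + 1)) (dP l))
    {π' : P' 0 →ₗ[E] S} (hπ' : Function.Surjective π') (hex0' : Function.Exact (dP' 0) π')
    (hex' : ∀ l, Function.Exact (dP' (l + 1)) (dP' l))
    {q : ∀ l, P l →ₗ[A] MatMod R (P' l)} (hq0 : theta ι π' ∘ₗ q 0 = π)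
    (hq : ∀ l, q l ∘ₗ dP l = MatMod.map R (dP' l) ∘ₗ q (l + 1)) {j k : ℕ}
    {x : ExtDeg A P j} {y : ExtDeg A P k} (hy : IsChainMap P dP k y)
    {x' : ExtDeg E P' j} {y' : ExtDeg E P' k} (hx' : IsChainMap P' dP' j x')
    (hy' : IsChainMap P' dP' k y')
    (hxx' : IsCob dP j (π ∘ₗ x 0 - theta ι (π' ∘ₗ x' 0) ∘ₗ q j))
    (hyy' : IsCob dP k (π ∘ₗ y 0 - theta ι (π' ∘ₗ y' 0) ∘ₗ q k)) :
    IsCob dP (j + k) (π ∘ₗ extComp P x y 0 - theta ι (π' ∘ₗ extComp P' x' y' 0) ∘ₗ q (j + k)) := by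
  set ξ : MatMod R (P' j) →ₗ[A] L := theta ι (π' ∘ₗ x' 0) with hξ
  have hξd : ξ ∘ₗ MatMod.map R (dP' j) = 0 := by
    rw [hξ, ← theta_comp, LinearMap.comp_assoc,
      show x' 0 ∘ₗ dP' j = _ from hx' 0, LinearMap.comp_smul, ← LinearMap.comp_assoc,
      show π' ∘ₗ dP' 0 = 0 from LinearMap.ext hex0'.apply_apply_eq_zero, LinearMap.zero_comp,
      smul_zero, theta_zero]
  have hρ : Function.Surjective (theta ι π') :=
    ι.surjective.comp (MatMod.map_surjective R hπ')
  have hρ0 : Function.Exact (MatMod.map R (dP' 0)) (theta ι π') := by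
    intro v
    rw [← MatMod.map_exact R hex0' v]
    exact map_eq_zero_iff ι ι.injective
  obtain ⟨H, hH0, hH⟩ := exists_homotopy hρ hρ0 (fun l => MatMod.map_exact R (hex' l))
    (fun l => LinearMap.ext (hex l).apply_apply_eq_zero) k
    (fun l => q l ∘ₗ y l - MatMod.map R (y' l) ∘ₗ q (k + l))
    (fun l => LinearMap.ext fun z => by
      have h1 : y l (dP (k + l) z) = ((-1 : ℤ) ^ k) • dP l (y (l + 1) z) :=
        LinearMap.congr_fun (hy l) z
      have h2 : ∀ l z, q l (dP l z) = MatMod.map R (dP' l) (q (l + 1) z) :=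
        fun l => LinearMap.congr_fun (hq l)
      have h3 : ∀ v, MatMod.map R (y' l) (MatMod.map R (dP' (k + l)) v) =
          ((-1 : ℤ) ^ k) • MatMod.map R (dP' l) (MatMod.map R (y' (l + 1)) v) := fun v =>
        LinearMap.congr_fun (congrArg (MatMod.map R) (hy' l)) v
      change q l (y l (dP (k + l) z)) - MatMod.map R (y' l) (q (k + l) (dP (k + l) z)) =
        ((-1 : ℤ) ^ k) • MatMod.map R (dP' l)
          (q (l + 1) (y (l + 1) z) - MatMod.map R (y' (l + 1)) (q (k + l + 1) z))
      rw [h1, map_zsmul, h2, h2, h3, map_sub, smul_sub])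
    (by
      rw [LinearMap.comp_sub, ← LinearMap.comp_assoc, hq0]
      exact hyy')
  have key : IsCob dP (k + j) (ξ ∘ₗ (q j ∘ₗ y j - MatMod.map R (y' j) ∘ₗ q (k + j))) := by
    cases j with
    | zero =>
      have := hH0.comp ξ
      rw [LinearMap.comp_sub _ _ ξ, ← LinearMap.comp_assoc _ _ ξ, hξd, LinearMap.zero_comp,
        sub_zero] at this
      exact this
    | succ j =>
      refine ⟨((-1 : ℤ) ^ k) • (ξ ∘ₗ H j), ?_⟩
      rw [hH j, LinearMap.comp_add, ← LinearMap.comp_assoc, hξd, LinearMap.zero_comp, zero_add,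
        LinearMap.comp_smul, LinearMap.smul_comp, LinearMap.comp_assoc]
      rfl
  have h1 : IsCob dP (k + j) ((π ∘ₗ x 0) ∘ₗ y j - ξ ∘ₗ MatMod.map R (y' j) ∘ₗ q (k + j)) := by
    have h2 := (isCob_comp_of_isChainMap hy hxx').add key
    rw [LinearMap.sub_comp, LinearMap.comp_sub, LinearMap.comp_assoc, LinearMap.comp_assoc,
      sub_add_sub_cancel] at h2
    exact h2
  have h3 := h1.comp_pcast (show j + k = k + j from add_comm j k)
  refine Eq.mp (congrArg _ ?_) h3
  refine LinearMap.ext fun z => ?_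
  have h4 := LinearMap.congr_fun (map_pcast_comp q (add_comm j k)) z
  exact congrArg (fun v => π (x 0 (y j (pcast (A := A) P (add_comm j k) z))) -
    ξ (MatMod.map R (y' j) v)) h4.symm

theorem exists_comparison [∀ l, Module.Projective A (P l)]
    {π : P 0 →ₗ[A] L} (hex0 : Function.Exact (dP 0) π)
    (hex : ∀ l, Function.Exact (dP (l + 1)) (dP l)) {Q : ℕ → Type*} [∀ l, AddCommGroup (Q l)]
    [∀ l, Module A (Q l)] {dQ : ∀ l, Q (l + 1) →ₗ[A] Q l} {ρ : Q 0 →ₗ[A] L}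
    (hρ : Function.Surjective ρ) (hQ0 : Function.Exact (dQ 0) ρ)
    (hQ : ∀ l, Function.Exact (dQ (l + 1)) (dQ l)) :
    ∃ q : ∀ l, P l →ₗ[A] Q l, ρ ∘ₗ q 0 = π ∧ ∀ l, q l ∘ₗ dP l = dQ l ∘ₗ q (l + 1) := by
  obtain ⟨g, hg0, hg⟩ := exists_chain_lift (fun l => LinearMap.ext (hex l).apply_apply_eq_zero)
    hρ hQ0 hQ 0 π (LinearMap.ext hex0.apply_apply_eq_zero)
  refine ⟨fun l => g l ∘ₗ pcast P (zero_add l).symm, hg0, fun l => LinearMap.ext fun x => ?_⟩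
  have h1 := LinearMap.congr_fun (hg l) (pcast (A := A) P (by omega : l + 1 = 0 + l + 1) x)
  rw [pow_zero, one_smul, LinearMap.comp_apply,
    d_pcast dP (a := l) (b := 0 + l) _ (by omega)] at h1
  exact h1

variable [∀ l, Module K (P l)] [∀ l, IsScalarTower K A (P l)] [∀ l, SMulCommClass A K (P l)]
  [∀ l, Module K (P' l)] [∀ l, IsScalarTower K E (P' l)] [∀ l, SMulCommClass E K (P' l)]

variable (K) in
/-- The class of a chain map in the cohomology of `Hom(P•, L)`. -/
def leftClass (π : P 0 →ₗ[A] L) (k : ℕ) : ExtDeg A P k →ₗ[K] (P k →ₗ[A] L) where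
  toFun g := π ∘ₗ g 0
  map_add' _ _ := LinearMap.comp_add _ _ _
  map_smul' _ _ := LinearMap.comp_smul _ _ _

variable (K) in
/-- The class of a chain map over `E`, transported to the cohomology of `Hom(P•, L)`. -/
def rightClass (hR : ∀ c : K, R (algebraMap K A c) = Matrix.scalar (Fin m) (algebraMap K E c))
    (π' : P' 0 →ₗ[E] S) (q : ∀ l, P l →ₗ[A] MatMod R (P' l)) (k : ℕ) :
    ExtDeg E P' k →ₗ[K] (P k →ₗ[A] L) where
  toFun f := theta ι (π' ∘ₗ f 0) ∘ₗ q k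
  map_add' f g := by
    refine LinearMap.ext fun x => ?_
    have h : π' ∘ₗ (f + g) 0 = π' ∘ₗ f 0 + π' ∘ₗ g 0 := LinearMap.comp_add _ _ _
    rw [h]
    exact map_add ι _ _
  map_smul' c f := by
    refine LinearMap.ext fun x => ?_
    have h : ∀ v : MatMod R (P' k), theta ι (π' ∘ₗ (c • f) 0) v =
        c • theta ι (π' ∘ₗ f 0) v := by
      intro v
      rw [← IsScalarTower.algebraMap_smul A c (theta ι (π' ∘ₗ f 0) v), ← map_smul]
      refine congrArg ι (MatMod.ext fun u => ?_)
      have h2 : MatMod.coord R (algebraMap K A c • v) u =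
          algebraMap K E c • MatMod.coord R v u := by
        rw [MatMod.coord_smul, hR]
        simp [Matrix.scalar_apply, Matrix.diagonal_apply]
      rw [MatMod.coord_map, MatMod.coord_map, h2, map_smul, LinearMap.comp_apply,
        Pi.smul_apply, LinearMap.smul_apply, ← IsScalarTower.algebraMap_smul E c, map_smul]
      rfl
    exact h (q k x)

end Comparison

/-- An algebra map from `A` to matrices over `E` for which `E ^ m` is `Hom(-, L)`-acyclic,
`S ^ m ≅ L` and `Hom_E(E, S) → Hom_A(E ^ m, S ^ m)` is surjective induces an isomorphism of
`Ext`-algebras. -/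
theorem exists_isGradedExtAlgIso {K : Type*} [Field K] {A E : Type u} [Ring A] [Ring E]
    [Algebra K A] [Algebra K E] {m : ℕ} (hm : 0 < m) (R : A →+* Matrix (Fin m) (Fin m) E)
    (hR : ∀ c : K, R (algebraMap K A c) = Matrix.scalar (Fin m) (algebraMap K E c))
    {L : Type u} [AddCommGroup L] [Module A L] [Module K L] [IsScalarTower K A L]
    [SMulCommClass A K L] {S : Type u} [AddCommGroup S] [Module E S]
    (ι : MatMod R S ≃ₗ[A] L)
    (hfull : ∀ τ : MatMod R E →ₗ[A] MatMod R S, ∃ σ : E →ₗ[E] S, MatMod.map R σ = τ)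
    (C : InjCoresolution A L) (hC : C.Acyclic (MatMod R E))
    (P : ℕ → Type u) [∀ l, AddCommGroup (P l)] [∀ l, Module A (P l)]
    [∀ l, Module K (P l)] [∀ l, IsScalarTower K A (P l)] [∀ l, SMulCommClass A K (P l)]
    (hproj : ∀ l, Module.Projective A (P l)) (dP : ∀ l, P (l + 1) →ₗ[A] P l)
    (π : P 0 →ₗ[A] L) (hπ : Function.Surjective π) (hex0 : Function.Exact (dP 0) π)
    (hex : ∀ l, Function.Exact (dP (l + 1)) (dP l))
    (P' : ℕ → Type u) [∀ l, AddCommGroup (P' l)] [∀ l, Module E (P' l)]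
    [∀ l, Module K (P' l)] [∀ l, IsScalarTower K E (P' l)] [∀ l, SMulCommClass E K (P' l)]
    (hproj' : ∀ l, Module.Projective E (P' l)) (dP' : ∀ l, P' (l + 1) →ₗ[E] P' l)
    (π' : P' 0 →ₗ[E] S) (hπ' : Function.Surjective π') (hex0' : Function.Exact (dP' 0) π')
    (hex' : ∀ l, Function.Exact (dP' (l + 1)) (dP' l)) :
    ∃ φ : ∀ k, extQ P dP K k ≃ₗ[K] extQ P' dP' K k, IsGradedExtAlgIso P dP P' dP' K φ := by
  have hρ : Function.Surjective (theta ι π') := ι.surjective.comp (MatMod.map_surjective R hπ')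
  have hρ0 : Function.Exact (MatMod.map R (dP' 0)) (theta ι π') := by
    intro v
    rw [← MatMod.map_exact R hex0' v]
    exact map_eq_zero_iff ι ι.injective
  obtain ⟨q, hq0, hq⟩ := exists_comparison (Q := fun l => MatMod R (P' l))
    (dQ := fun l => MatMod.map R (dP' l)) hex0 hex hρ hρ0 (fun l => MatMod.map_exact R (hex' l))
  have hdP : ∀ l, dP l ∘ₗ dP (l + 1) = 0 := fun l =>
    LinearMap.ext (hex l).apply_apply_eq_zero
  have hdP' : ∀ l, dP' l ∘ₗ dP' (l + 1) = 0 := fun l =>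
    LinearMap.ext (hex' l).apply_apply_eq_zero
  have hπd : π ∘ₗ dP 0 = 0 := LinearMap.ext hex0.apply_apply_eq_zero
  have hπd' : π' ∘ₗ dP' 0 = 0 := LinearMap.ext hex0'.apply_apply_eq_zero
  have hPa : ∀ l, C.Acyclic (P l) := fun l => InjCoresolution.Acyclic.of_projective
  have hQa : ∀ l, C.Acyclic (MatMod R (P' l)) := fun l => MatMod.acyclic hC (P' l)
  have hcoc : ∀ {k} {g : ExtDeg A P k}, IsChainMap P dP k g → (π ∘ₗ g 0) ∘ₗ dP k = 0 := by
    intro k g hg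
    rw [LinearMap.comp_assoc, show g 0 ∘ₗ dP k = _ from hg 0, LinearMap.comp_smul,
      ← LinearMap.comp_assoc, hπd, LinearMap.zero_comp, smul_zero]
  have hcoc' : ∀ {k} {f : ExtDeg E P' k}, IsChainMap P' dP' k f →
      (π' ∘ₗ f 0) ∘ₗ dP' k = 0 := by
    intro k g hg
    rw [LinearMap.comp_assoc, show g 0 ∘ₗ dP' k = _ from hg 0, LinearMap.comp_smul,
      ← LinearMap.comp_assoc, hπd', LinearMap.zero_comp, smul_zero]
  have hθ : ∀ {k} {f : ExtDeg E P' k}, IsChainMap P' dP' k f →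
      theta ι (π' ∘ₗ f 0) ∘ₗ MatMod.map R (dP' k) = 0 := fun {k f} hf =>
    (theta_comp ι (π' ∘ₗ f 0) (dP' k)).symm.trans
      ((congrArg (theta ι) (hcoc' hf)).trans (theta_zero ι))
  let α (k : ℕ) : ↥(chainSub P dP K k) →ₗ[K] (P k →ₗ[A] L) ⧸ cobSub K dP k :=
    (cobSub K dP k).mkQ ∘ₗ leftClass K π k ∘ₗ (chainSub P dP K k).subtype
  let β (k : ℕ) : ↥(chainSub P' dP' K k) →ₗ[K] (P k →ₗ[A] L) ⧸ cobSub K dP k :=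
    (cobSub K dP k).mkQ ∘ₗ rightClass K ι hR π' q k ∘ₗ (chainSub P' dP' K k).subtype
  have hker : ∀ k, LinearMap.ker (α k) =
      Submodule.comap (chainSub P dP K k).subtype (nullSub P dP K k) := by
    intro k
    refine le_antisymm ?_ ?_
    · rintro ⟨g, hg⟩ h
      have h1 : IsCob dP k (π ∘ₗ g 0) := (Submodule.Quotient.mk_eq_zero _).1 h
      exact Submodule.subset_span
        (isNullMap_of_isCob hπ hex0 hex (isChainMap_of_mem_chainSub hg) h1)
    · rintro ⟨g, hg⟩ h
      have h1 : nullSub P dP K k ≤ (cobSub K dP k).comap (leftClass K π k) :=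
        Submodule.span_le.2 fun f hf => hf.isCob hπd
      exact (Submodule.Quotient.mk_eq_zero _).2 (h1 h)
  have hker' : ∀ k, LinearMap.ker (β k) =
      Submodule.comap (chainSub P' dP' K k).subtype (nullSub P' dP' K k) := by
    intro k
    refine le_antisymm ?_ ?_
    · rintro ⟨f, hf⟩ h
      have hf' := isChainMap_of_mem_chainSub hf
      have h1 : IsCob dP k (theta ι (π' ∘ₗ f 0) ∘ₗ q k) :=
        (Submodule.Quotient.mk_eq_zero _).1 h
      have h2 := isCob_of_isCob_comp (Q := fun l => MatMod R (P' l))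
        (dQ := fun l => MatMod.map R (dP' l)) hPa hQa hπ hex0 hex
        hρ0 (fun l => MatMod.map_exact R (hex' l)) hq0 hq (theta ι (π' ∘ₗ f 0))
        (hθ hf') h1
      exact Submodule.subset_span
        (isNullMap_of_isCob hπ' hex0' hex' hf' (isCob_of_theta ι hm hfull h2))
    · rintro ⟨f, hf⟩ h
      have h1 : nullSub P' dP' K k ≤ (cobSub K dP k).comap (rightClass K ι hR π' q k) :=
        Submodule.span_le.2 fun f hf => isCob_comp_chain hq (isCob_theta ι (hf.isCob hπd'))
      exact (Submodule.Quotient.mk_eq_zero _).2 (h1 h)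
  have hrange : ∀ k, LinearMap.range (α k) = LinearMap.range (β k) := by
    intro k
    refine le_antisymm ?_ ?_
    · rintro _ ⟨⟨g, hg⟩, rfl⟩
      obtain ⟨τ, hτ, hcob⟩ := exists_isCob_sub_comp (Q := fun l => MatMod R (P' l))
        (dQ := fun l => MatMod.map R (dP' l)) hPa
        hQa hπ hex0 hex hρ0 (fun l => MatMod.map_exact R (hex' l)) hq0 hq (k := k) (π ∘ₗ g 0)
        (hcoc (isChainMap_of_mem_chainSub hg))
      obtain ⟨σ, rfl⟩ := exists_theta_eq ι hm hfull τ
      have hσ : σ ∘ₗ dP' k = 0 := theta_injective ι hm (hτ.trans (theta_zero ι).symm)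
      obtain ⟨f, hf0, hf⟩ := exists_chain_lift hdP' hπ' hex0' hex' k σ hσ
      refine ⟨⟨f, Submodule.subset_span hf⟩, ?_⟩
      refine ((Submodule.Quotient.eq _).2 ?_).symm
      change IsCob dP k (π ∘ₗ g 0 - theta ι (π' ∘ₗ f 0) ∘ₗ q k)
      rw [hf0]
      exact hcob
    · rintro _ ⟨⟨f, hf⟩, rfl⟩
      have h0 : (theta ι (π' ∘ₗ f 0) ∘ₗ q k) ∘ₗ dP k = 0 := by
        rw [LinearMap.comp_assoc, hq, ← LinearMap.comp_assoc,
          hθ (isChainMap_of_mem_chainSub hf), LinearMap.zero_comp]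
      obtain ⟨g, hg0, hg⟩ := exists_chain_lift hdP hπ hex0 hex k _ h0
      refine ⟨⟨g, Submodule.subset_span hg⟩, ?_⟩
      exact congrArg (Submodule.Quotient.mk (p := cobSub K dP k)) hg0
  choose φ hφ using fun k => exists_quotient_equiv (α k) (β k) _ _ (hker k) (hker' k) (hrange k)
  have hφ' : ∀ k (x : ExtDeg A P k) (x' : ExtDeg E P' k) (hx : IsChainMap P dP k x)
      (hx' : IsChainMap P' dP' k x'), φ k (extMk P dP K k x hx) = extMk P' dP' K k x' hx' ↔
        IsCob dP k (π ∘ₗ x 0 - theta ι (π' ∘ₗ x' 0) ∘ₗ q k) := fun k x x' hx hx' =>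
    (hφ k _ _).trans (Submodule.Quotient.eq _)
  refine ⟨φ, fun hid hid' => (hφ' _ _ _ _ _).2 ?_, fun j k x y hx hy hxy x' y' hx' hy' hxy'
    hxx hyy => (hφ' _ _ _ _ _).2 ?_⟩
  · change π - theta ι π' ∘ₗ q 0 = 0
    rw [hq0, sub_self]
  · exact isCob_extComp ι hex hπ' hex0' hex' hq0 hq hy hx' hy' ((hφ' _ _ _ _ _).1 hxx)
      ((hφ' _ _ _ _ _).1 hyy)

theorem jacRad_eq_jacobson (A : Type*) [Ring A] : jacRad A = Ideal.jacobson ⊥ := by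
  simp [jacRad, Ideal.jacobson]

theorem mul_mem_jacRad {A : Type*} [Ring A] {x : A} (hx : x ∈ jacRad A) (a : A) :
    x * a ∈ jacRad A := by
  rw [jacRad, ← Ring.jacobson_eq_sInf_isMaximal] at *
  exact Ideal.mul_mem_right a _ hx

theorem mem_jacRad_of_isNilpotent {A : Type*} [Ring A] {x : A} (h : ∀ y, IsNilpotent (y * x)) :
    x ∈ jacRad A := by
  rw [jacRad_eq_jacobson, Ideal.mem_jacobson_iff]
  intro y
  obtain ⟨z, hz⟩ := (h y).isUnit_one_add.exists_left_inv
  refine ⟨z, (Submodule.mem_bot A).2 ?_⟩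
  rw [← hz]
  noncomm_ring

theorem IsIdempotentElem.eq_zero_of_mem_jacRad {A : Type*} [Ring A] {x : A}
    (hx : IsIdempotentElem x) (h : x ∈ jacRad A) : x = 0 := by
  rw [jacRad_eq_jacobson, Ideal.mem_jacobson_iff] at h
  obtain ⟨z, hz⟩ := h (-1)
  have h1 : z * -1 * x + z - 1 = 0 := hz
  have h2 : (z * -1 * x + z - 1) * x = -x := by
    rw [sub_mul, add_mul, mul_assoc _ x x, hx.eq]
    noncomm_ring
  rw [h1, zero_mul] at h2
  exact neg_eq_zero.1 h2.symm

theorem isNilpotent_of_mem_jacRad {A : Type*} [Ring A] [IsArtinianRing A] {x : A}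
    (hx : x ∈ jacRad A) : IsNilpotent x := by
  obtain ⟨k, hk⟩ := IsArtinianRing.isNilpotent_jacobson_bot (R := A)
  rw [jacRad_eq_jacobson] at hx
  refine ⟨k, ?_⟩
  have := Ideal.pow_mem_pow hx k
  rwa [hk] at this

theorem jacRad_eq_of_isUnit {A : Type*} [Ring A] {I : Ideal A} (hI : I ≠ ⊤)
    (h : ∀ x, x ∉ I → IsUnit x) : jacRad A = I := by
  have hle : ∀ J : Ideal A, J ≠ ⊤ → J ≤ I := fun J hJ x hx => by
    by_contra hxI
    exact hJ (Ideal.eq_top_of_isUnit_mem J hx (h x hxI))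
  have hmax : I.IsMaximal := ⟨hI, fun J hJ => by
    by_contra hne
    exact absurd (hle J hne) (not_le_of_gt hJ)⟩
  refine le_antisymm (sInf_le hmax) (le_sInf fun J hJ => ?_)
  exact (hJ.eq_of_le hI (hle J hJ.ne_top)).ge

namespace IsPrimitiveIdem

variable {A : Type*} [Ring A] {x : A}

theorem eq_zero_or_eq (hx : IsPrimitiveIdem A x) {f : A} (hf : IsIdempotentElem f)
    (h1 : x * f = f) (h2 : f * x = f) : f = 0 ∨ f = x := by
  have h := hx.2.2 f (x - f) hf
    (by
      change (x - f) * (x - f) = x - f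
      rw [sub_mul, mul_sub, mul_sub, h1, h2, hx.1.eq, hf.eq, sub_self, sub_zero])
    (by rw [mul_sub, h2, hf.eq, sub_self])
    (by rw [sub_mul, h1, hf.eq, sub_self]) (by abel)
  exact h.imp_right fun h => (sub_eq_zero.1 h).symm

/-- A corner of a finite-dimensional algebra at a primitive idempotent is local. -/
theorem isNilpotent_or_exists_mul_eq (K : Type*) [Field K] [Algebra K A] [FiniteDimensional K A]
    (hx : IsPrimitiveIdem A x) {c : A} (h1 : x * c = c) (h2 : c * x = c) :
    IsNilpotent c ∨ ∃ z, z * c = x := by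
  classical
  have hc : IsIntegral K c := Algebra.IsIntegral.isIntegral c
  obtain ⟨q, hq, hnd⟩ := Polynomial.exists_eq_pow_rootMultiplicity_mul_and_not_dvd _
    (minpoly.ne_zero hc) (0 : K)
  set k := (minpoly K c).rootMultiplicity 0
  rw [map_zero, sub_zero] at hq hnd
  have hcop : IsCoprime (Polynomial.X ^ (k + 1) : Polynomial K) q :=
    ((Polynomial.irreducible_X.coprime_iff_not_dvd).2 hnd).pow_left
  obtain ⟨a, b, hab⟩ := hcop
  set y := Polynomial.aeval c a
  have hcy : Commute c y := by
    have := Polynomial.aeval_X (R := K) c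
    rw [commute_iff_eq]
    conv_lhs => rw [← this]
    conv_rhs => rw [← this]
    rw [← map_mul, ← map_mul, mul_comm]
  have hfix : y * c ^ (k + 1) * c ^ k = c ^ k := by
    have h3 : a * Polynomial.X ^ (k + 1) * Polynomial.X ^ k + b * minpoly K c =
        Polynomial.X ^ k := by
      rw [hq]
      linear_combination Polynomial.X ^ k * hab
    have h4 := congrArg (Polynomial.aeval c) h3
    simpa using h4
  set f := y * c ^ (k + 1) with hf
  have hfc : f = c * (y * c ^ k) := by
    rw [hf, pow_succ', ← mul_assoc, ← mul_assoc, hcy.eq]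
  have hfc' : f = y * c ^ k * c := by rw [hf, pow_succ, mul_assoc]
  have hff : IsIdempotentElem f := by
    have h5 : f * (c ^ k * (y * c)) = f := by
      rw [← mul_assoc, hfix, hf]
      rw [← mul_assoc, (hcy.pow_left k).eq, mul_assoc, ← pow_succ]
    have h6 : c ^ k * (y * c) = f := by
      rw [← mul_assoc, (hcy.pow_left k).eq, mul_assoc, ← pow_succ]
    rw [h6] at h5
    exact h5
  rcases hx.eq_zero_or_eq hff (by rw [hfc, ← mul_assoc, h1]) (by
    rw [hfc', mul_assoc, h2]) with h0 | h0
  · refine Or.inl ⟨k, ?_⟩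
    rw [← hfix, h0, zero_mul]
  · exact Or.inr ⟨y * c ^ k, by rw [← hfc', h0]⟩

/-- An element of `xAy`, with `x` and `y` primitive, that is not in the radical is invertible. -/
theorem exists_inverse_of_notMem_jacRad (K : Type*) [Field K] [Algebra K A]
    [FiniteDimensional K A] {y : A} (hx : IsPrimitiveIdem A x)
    (hy : IsPrimitiveIdem A y) {c : A} (h1 : x * c = c) (h2 : c * y = c) (hc : c ∉ jacRad A) :
    ∃ z, y * z = z ∧ z * x = z ∧ z * c = y ∧ c * z = x := by
  have h3 : ∃ z, z * c = y := by
    by_contra hno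
    refine hc (mem_jacRad_of_isNilpotent fun w => ?_)
    rcases hy.isNilpotent_or_exists_mul_eq K (c := y * (w * c))
      (by rw [← mul_assoc, hy.1.eq]) (by rw [mul_assoc, mul_assoc, h2]) with h | ⟨d, hd⟩
    · obtain ⟨k, hk⟩ := h
      refine ⟨k + 1, ?_⟩
      have h4 : ∀ k, (w * c) ^ (k + 1) = w * c * (y * (w * c)) ^ k := by
        intro k
        induction k with
        | zero => simp
        | succ k ih =>
          have h5 (Q : A) : w * c * (y * (w * c) * Q) = w * (c * y) * (w * c * Q) := by
            noncomm_ring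
          rw [pow_succ', ih, pow_succ' (y * (w * c)), h5, h2]
      rw [h4, hk, mul_zero]
    · exact (hno ⟨d * (y * w), by simpa only [mul_assoc] using hd⟩).elim
  obtain ⟨z, hz⟩ := h3
  refine ⟨y * z * x, ?_, ?_, ?_, ?_⟩
  · rw [← mul_assoc, ← mul_assoc, hy.1.eq]
  · rw [mul_assoc, hx.1.eq]
  · rw [mul_assoc, h1, mul_assoc, hz, hy.1.eq]
  · have h5 : y * z * x * c = y := by rw [mul_assoc, h1, mul_assoc, hz, hy.1.eq]
    have h6 : IsIdempotentElem (c * (y * z * x)) := by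
      change c * (y * z * x) * (c * (y * z * x)) = _
      rw [mul_assoc, ← mul_assoc _ c, h5, ← mul_assoc y, ← mul_assoc y, hy.1.eq]
    refine (hx.eq_zero_or_eq h6 (by rw [← mul_assoc, h1]) (by
      rw [mul_assoc, mul_assoc _ x x, hx.1.eq])).resolve_left fun h0 => hy.2.1 ?_
    calc y = y * z * x * c * (y * z * x * c) := by rw [h5, hy.1.eq]
      _ = y * z * x * (c * (y * z * x)) * c := by noncomm_ring
      _ = 0 := by rw [h0, mul_zero, zero_mul]

theorem exists_sub_smul_mem_jacRad (K : Type*) [Field K] [Algebra K A]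
    [FiniteDimensional K A] [IsAlgClosed K] (hx : IsPrimitiveIdem A x) {c : A}
    (h1 : x * c = c) (h2 : c * x = c) : ∃ r : K, c - r • x ∈ jacRad A := by
  let V : Submodule K A := LinearMap.range (LinearMap.mulRight K x)
  have hV : ∀ v ∈ V, v * x = v := by
    rintro _ ⟨v, rfl⟩
    rw [LinearMap.mulRight_apply, mul_assoc, hx.1.eq]
  have hxV : x ∈ V := ⟨1, one_mul x⟩
  have : Nontrivial V := ⟨⟨⟨x, hxV⟩, 0, fun h => hx.2.1 (congrArg Subtype.val h)⟩⟩
  let T : Module.End K V := (LinearMap.mulRight K c).restrict (p := V) (q := V) (by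
    intro v _
    exact ⟨v * c, by rw [LinearMap.mulRight_apply, LinearMap.mulRight_apply, mul_assoc, h2]⟩)
  obtain ⟨r, hr⟩ := Module.End.exists_eigenvalue T
  obtain ⟨v, hv⟩ := hr.exists_hasEigenvector
  have hvc : (v : A) * c = r • (v : A) := congrArg Subtype.val hv.apply_eq_smul
  refine ⟨r, ?_⟩
  by_contra hn
  obtain ⟨z, _, _, _, hz⟩ := exists_inverse_of_notMem_jacRad K hx hx (c := c - r • x)
    (by rw [mul_sub, h1, mul_smul_comm, hx.1.eq])
    (by rw [sub_mul, h2, smul_mul_assoc, hx.1.eq]) hn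
  refine hv.2 (Subtype.ext ?_)
  calc (v : A) = v * x := (hV v v.2).symm
    _ = (v * (c - r • x)) * z := by rw [mul_assoc, hz]
    _ = 0 := by rw [mul_sub, hvc, mul_smul_comm, hV v v.2, sub_self, zero_mul]

end IsPrimitiveIdem

section LeftIdeal

variable {A : Type*} [Ring A] {a : A}

/-- The generator of the left ideal `Aa`. -/
def leftIdealGen (a : A) : leftIdeal A a := ⟨a, 1, one_mul a⟩

theorem leftIdeal_mul_eq (ha : IsIdempotentElem a) (y : leftIdeal A a) : (y : A) * a = y := by
  obtain ⟨_, z, rfl⟩ := y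
  change z * a * a = z * a
  rw [mul_assoc, ha.eq]

theorem leftIdeal_eq_smul_gen (ha : IsIdempotentElem a) (y : leftIdeal A a) :
    y = (y : A) • leftIdealGen a := Subtype.ext (leftIdeal_mul_eq ha y).symm

/-- The map `Aa → M` sending the generator to `a • x`. -/
def leftIdealHom {M : Type*} [AddCommGroup M] [Module A M] (a : A) (x : M) :
    leftIdeal A a →ₗ[A] M := (LinearMap.toSpanSingleton A M x).domRestrict _

theorem leftIdeal_projective (ha : IsIdempotentElem a) : Module.Projective A (leftIdeal A a) :=
  Module.Projective.of_split (leftIdeal A a).subtype (leftIdealHom 1 (leftIdealGen a) ∘ₗ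
    LinearMap.codRestrict _ LinearMap.id fun x => ⟨x, mul_one x⟩)
    (LinearMap.ext fun y => (leftIdeal_eq_smul_gen ha y).symm)

theorem IsPrimitiveIdem.mem_jacRad {K : Type*} [Field K] [Algebra K A] [FiniteDimensional K A]
    {x y c : A} (hx : IsPrimitiveIdem A x) (hy : IsPrimitiveIdem A y)
    (hxy : ¬ Nonempty (↥(leftIdeal A x) ≃ₗ[A] ↥(leftIdeal A y))) (h1 : x * c = c)
    (h2 : c * y = c) : c ∈ jacRad A := by
  by_contra hc
  obtain ⟨z, hz1, hz2, hz3, hz4⟩ := hx.exists_inverse_of_notMem_jacRad K hy h1 h2 hc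
  refine hxy ⟨LinearEquiv.ofLinearMap (leftIdealHom x ⟨c, c, h2⟩) (leftIdealHom y ⟨z, z, hz2⟩)
    ?_ ?_⟩
  · ext v
    change (v : A) * z * c = v
    rw [mul_assoc, hz3, leftIdeal_mul_eq hy.1]
  · ext v
    change (v : A) * c * z = v
    rw [mul_assoc, hz4, leftIdeal_mul_eq hx.1]

theorem coe_mem_jacRad_of_mem_radM {y : leftIdeal A a} (hy : y ∈ radM A ↥(leftIdeal A a)) :
    (y : A) ∈ jacRad A := by
  have : radM A ↥(leftIdeal A a) ≤ Submodule.comap (leftIdeal A a).subtype (jacRad A) := by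
    refine Submodule.span_le.2 ?_
    rintro _ ⟨r, hr, m, rfl⟩
    exact mul_mem_jacRad hr _
  exact this hy

theorem mem_radM_of_coe_mem (ha : IsIdempotentElem a) {y : leftIdeal A a}
    (hy : (y : A) ∈ jacRad A) : y ∈ radM A ↥(leftIdeal A a) :=
  Submodule.subset_span ⟨y, hy, leftIdealGen a, leftIdeal_eq_smul_gen ha y⟩

variable {n : ℕ} {e : Fin n → A} (hidem : ∀ i, IsPrimitiveIdem A (e i))
include hidem

theorem mem_properU {i j : Fin n} (hij : i ≤ j) {y : leftIdeal A (e i)}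
    (hy : (y : A) ∈ jacRad A) (hjy : e j • y = y) : y ∈ properU A e i := by
  refine Submodule.mem_iSup_of_mem j (Submodule.mem_iSup_of_mem hij
    (Submodule.mem_iSup_of_mem (leftIdealHom (e j) y) (Submodule.mem_iSup_of_mem ?_
      ⟨leftIdealGen (e j), hjy⟩)))
  rintro _ ⟨z, rfl⟩
  exact Submodule.smul_mem _ _ (mem_radM_of_coe_mem (hidem i).1 hy)

theorem properU_le {i : Fin n} {N : Submodule A ↥(leftIdeal A (e i))}
    (h : ∀ j, i ≤ j → ∀ y : leftIdeal A (e i), (y : A) ∈ jacRad A → e j • y = y → y ∈ N) :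
    properU A e i ≤ N := by
  refine iSup_le fun j => iSup_le fun hij => iSup_le fun φ => iSup_le fun hφ => ?_
  rintro _ ⟨z, rfl⟩
  rw [leftIdeal_eq_smul_gen (hidem j).1 z, map_smul]
  refine N.smul_mem _ (h j hij _ (coe_mem_jacRad_of_mem_radM (hφ ⟨_, rfl⟩)) ?_)
  rw [← map_smul]
  exact congrArg φ (leftIdeal_eq_smul_gen (hidem j).1 (leftIdealGen (e j))).symm

theorem stdU_le {i : Fin n} {N : Submodule A ↥(leftIdeal A (e i))}
    (h : ∀ j, i < j → ∀ y : leftIdeal A (e i), e j • y = y → y ∈ N) : stdU A e i ≤ N := by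
  refine iSup_le fun j => iSup_le fun hij => iSup_le fun φ => ?_
  rintro _ ⟨z, rfl⟩
  rw [leftIdeal_eq_smul_gen (hidem j).1 z, map_smul]
  refine N.smul_mem _ (h j hij _ ?_)
  rw [← map_smul]
  exact congrArg φ (leftIdeal_eq_smul_gen (hidem j).1 (leftIdealGen (e j))).symm

theorem properU_coe_mem {i : Fin n} {y : leftIdeal A (e i)} (hy : y ∈ properU A e i) :
    (y : A) ∈ jacRad A :=
  properU_le hidem (N := Submodule.comap (leftIdeal A (e i)).subtype (jacRad A))
    (fun _ _ _ hy _ => hy) hy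

omit hidem in
theorem mem_stdU {i j : Fin n} (hij : i < j) {y : leftIdeal A (e i)} (hjy : e j • y = y) :
    y ∈ stdU A e i :=
  Submodule.mem_iSup_of_mem j (Submodule.mem_iSup_of_mem hij
    (Submodule.mem_iSup_of_mem (leftIdealHom (e j) y) ⟨leftIdealGen (e j), hjy⟩))

end LeftIdeal

section Standard

variable {A : Type*} [Ring A] {n : ℕ} {e : Fin n → A}

/-- The generator of the properly standard module. -/
def pstdGen (e : Fin n → A) (i : Fin n) : PStd A e i :=
  Submodule.Quotient.mk (leftIdealGen (e i))

variable (hidem : ∀ i, IsPrimitiveIdem A (e i))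
  (hbasic : ∀ i j, i ≠ j → ¬ Nonempty (↥(leftIdeal A (e i)) ≃ₗ[A] ↥(leftIdeal A (e j))))

include hidem

theorem idem_smul_self {M : Type*} [AddCommGroup M] [Module A M] (i : Fin n) (x : M) :
    e i • e i • x = e i • x := by rw [← mul_smul, (hidem i).1.eq]

theorem smul_pstdGen {i : Fin n} (y : leftIdeal A (e i)) :
    (y : A) • pstdGen e i = Submodule.Quotient.mk y :=
  (congrArg Submodule.Quotient.mk (leftIdeal_eq_smul_gen (hidem i).1 y)).symm

theorem exists_smul_pstdGen {i : Fin n} (v : PStd A e i) :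
    ∃ y : leftIdeal A (e i), v = (y : A) • pstdGen e i := by
  obtain ⟨y, rfl⟩ := Submodule.Quotient.mk_surjective _ v
  exact ⟨y, (smul_pstdGen hidem y).symm⟩

theorem idem_smul_pstdGen (i : Fin n) : e i • pstdGen e i = pstdGen e i :=
  smul_pstdGen hidem (leftIdealGen (e i))

theorem pstdGen_ne_zero (i : Fin n) : pstdGen e i ≠ 0 := fun h =>
  (hidem i).2.1 ((hidem i).1.eq_zero_of_mem_jacRad
    (properU_coe_mem hidem ((Submodule.Quotient.mk_eq_zero _).1 h)))

theorem smul_pstdGen_eq_zero {i j : Fin n} (hij : i ≤ j) {c : A} (hc : c ∈ jacRad A)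
    (h : e j * c = c) : c • pstdGen e i = 0 := by
  refine (Submodule.Quotient.mk_eq_zero _).2 (mem_properU hidem hij (mul_mem_jacRad hc _) ?_)
  exact Subtype.ext (by
    change e j * (c * e i) = c * e i
    rw [← mul_assoc, h])

theorem smul_eq_zero_of_mem_stdU {M : Type*} [AddCommGroup M] [Module A M] {i : Fin n}
    (hM : ∀ j, i < j → ∀ x : M, e j • x = 0) {y : leftIdeal A (e i)} (hy : y ∈ stdU A e i)
    (x : M) : (y : A) • x = 0 :=
  stdU_le hidem (N := LinearMap.ker (leftIdealHom (e i) x)) (fun j hij y hjy => by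
    rw [LinearMap.mem_ker, ← hjy, map_smul]
    exact hM j hij _) hy

theorem idem_smul_std_eq_zero {i j : Fin n} (hij : i < j)
    (v : Std A e i) : e j • v = 0 := by
  obtain ⟨y, rfl⟩ := Submodule.Quotient.mk_surjective _ v
  exact (Submodule.Quotient.mk_eq_zero _).2 (mem_stdU hij (idem_smul_self hidem j y))

variable (K : Type*) [Field K] [Algebra K A] [FiniteDimensional K A]

include hbasic K in
theorem idem_smul_pstd_eq_zero {i j : Fin n} (hij : i < j) (v : PStd A e i) : e j • v = 0 := by
  obtain ⟨y, rfl⟩ := exists_smul_pstdGen hidem v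
  rw [← mul_smul]
  refine smul_pstdGen_eq_zero hidem hij.le ((hidem j).mem_jacRad (K := K) (hidem i)
    (hbasic j i hij.ne') ?_ ?_) ?_
  · rw [← mul_assoc, (hidem j).1.eq]
  · rw [mul_assoc, leftIdeal_mul_eq (hidem i).1]
  · rw [← mul_assoc, (hidem j).1.eq]

theorem exists_smul_pstdGen_eq [IsAlgClosed K] {i : Fin n} {v : PStd A e i} (hv : e i • v = v) :
    ∃ r : K, v = r • pstdGen e i := by
  obtain ⟨y, rfl⟩ := exists_smul_pstdGen hidem v
  obtain ⟨r, hr⟩ := (hidem i).exists_sub_smul_mem_jacRad K (c := e i * y)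
    (by rw [← mul_assoc, (hidem i).1.eq]) (by rw [mul_assoc, leftIdeal_mul_eq (hidem i).1])
  have := smul_pstdGen_eq_zero hidem le_rfl hr (by
    rw [mul_sub, ← mul_assoc, (hidem i).1.eq, mul_smul_comm, (hidem i).1.eq])
  refine ⟨r, ?_⟩
  rw [sub_smul, mul_smul, hv, smul_assoc, idem_smul_pstdGen hidem, sub_eq_zero] at this
  exact this

end Standard

section Chi

theorem finrank_eq_add_of_exact {K : Type*} [Field K] {N M Q : Type*} [AddCommGroup N]
    [Module K N] [AddCommGroup M] [Module K M] [AddCommGroup Q] [Module K Q]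
    [FiniteDimensional K M] {i : N →ₗ[K] M} {p : M →ₗ[K] Q} (hi : Function.Injective i)
    (hp : Function.Surjective p) (hex : Function.Exact i p) :
    Module.finrank K M = Module.finrank K N + Module.finrank K Q := by
  rw [← p.finrank_range_add_finrank_ker, LinearMap.range_eq_top.2 hp, finrank_top,
    LinearMap.exact_iff.1 hex, LinearMap.finrank_range_of_inj hi, add_comm]

variable {K : Type*} [Field K] {A : Type*} [Ring A] [Algebra K A]

/-- The part `f • M` of a module cut out by an element of the algebra. -/
def idemPart (K : Type*) [Field K] {A : Type*} [Ring A] [Algebra K A] (f : A) (M : Type*)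
    [AddCommGroup M] [Module A M] [Module K M] [IsScalarTower K A M] : Submodule K M :=
  LinearMap.range (Algebra.lsmul K K M f)

variable {N M Q : Type*} [AddCommGroup N] [Module A N] [Module K N] [IsScalarTower K A N]
  [AddCommGroup M] [Module A M] [Module K M] [IsScalarTower K A M]
  [AddCommGroup Q] [Module A Q] [Module K Q] [IsScalarTower K A Q]

theorem mem_idemPart {f : A} (hf : IsIdempotentElem f) {x : M} :
    x ∈ idemPart K f M ↔ f • x = x := by
  refine ⟨?_, fun h => ⟨x, h⟩⟩
  rintro ⟨y, rfl⟩
  change f • f • y = f • y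
  rw [← mul_smul, hf.eq]

theorem map_mem_idemPart {f : A} (hf : IsIdempotentElem f) (g : M →ₗ[A] N) {x : M}
    (hx : x ∈ idemPart K f M) : g x ∈ idemPart K f N := by
  rw [mem_idemPart hf] at hx ⊢
  rw [← map_smul, hx]

/-- The additive function `dim M - c * dim (f • M)`. -/
def chi (K : Type*) [Field K] {A : Type*} [Ring A] [Algebra K A] (f : A) (c : ℤ) (M : Type*)
    [AddCommGroup M] [Module A M] [Module K M] [IsScalarTower K A M] : ℤ :=
  Module.finrank K M - c * Module.finrank K (idemPart K f M)

theorem chi_eq_add_of_exact [FiniteDimensional K M] {f : A} (hf : IsIdempotentElem f) (c : ℤ)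
    {i : N →ₗ[A] M} {p : M →ₗ[A] Q} (hi : Function.Injective i) (hp : Function.Surjective p)
    (hex : Function.Exact i p) : chi K f c M = chi K f c N + chi K f c Q := by
  have h1 := finrank_eq_add_of_exact (K := K) (i := i.restrictScalars K)
    (p := p.restrictScalars K) hi hp hex
  have h2 := finrank_eq_add_of_exact (K := K)
    (i := (i.restrictScalars K).restrict (p := idemPart K f N) (q := idemPart K f M)
      (fun _ => map_mem_idemPart hf i))
    (p := (p.restrictScalars K).restrict (p := idemPart K f M) (q := idemPart K f Q)
      (fun _ => map_mem_idemPart hf p))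
    (fun x y hxy => Subtype.ext (hi (congrArg Subtype.val hxy)))
    (by
      rintro ⟨y, hy⟩
      rw [mem_idemPart hf] at hy
      obtain ⟨x, rfl⟩ := hp y
      exact ⟨⟨f • x, x, rfl⟩, Subtype.ext ((map_smul p f x).trans hy)⟩)
    (by
      rintro ⟨y, hy⟩
      rw [mem_idemPart hf] at hy
      refine ⟨fun h => ?_, ?_⟩
      · obtain ⟨x, rfl⟩ := (hex y).1 (congrArg Subtype.val h)
        exact ⟨⟨f • x, x, rfl⟩, Subtype.ext ((map_smul i f x).trans hy)⟩
      · rintro ⟨x, hx⟩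
        exact Subtype.ext ((hex y).2 ⟨x, congrArg Subtype.val hx⟩))
  rw [chi, chi, chi, h1, h2]
  push_cast
  ring

end Chi

section Filtration

variable {A : Type u} [Ring A] {n : ℕ} {e : Fin n → A}

theorem HasPStdFilt.exists_maps {cond : Fin n → Prop} {M : Type u} [AddCommGroup M] [Module A M]
    (h : HasPStdFilt A e cond M) : ∃ (m : ℕ) (X : ℕ → Submodule A M), X 0 = ⊤ ∧ X m = ⊥ ∧
      (∀ t, X (t + 1) ≤ X t) ∧ ∀ t < m, ∃ j, cond j ∧ ∃ p : X t →ₗ[A] PStd A e j,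
        Function.Surjective p ∧ ∀ x : X t, p x = 0 ↔ (x : M) ∈ X (t + 1) := by
  obtain ⟨m, X, h0, hm, hX, h⟩ := h
  refine ⟨m, X, h0, hm, hX, fun t ht => ?_⟩
  obtain ⟨j, hj, ⟨θ⟩⟩ := h t ht
  refine ⟨j, hj, θ.toLinearMap ∘ₗ Submodule.mkQ _,
    θ.surjective.comp (Submodule.mkQ_surjective _), fun x => ?_⟩
  exact (map_eq_zero_iff θ θ.injective).trans (Submodule.Quotient.mk_eq_zero _)

theorem extVanish_filtration {L : Type u} [AddCommGroup L] [Module A L] {C : InjCoresolution A L}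
    {k : ℕ} {M : Type u} [AddCommGroup M] [Module A M] {m : ℕ} {X : ℕ → Submodule A M}
    (hm : X m = ⊥) (hX : ∀ t, X (t + 1) ≤ X t) {s : ℕ} (hs : s ≤ m)
    (h : ∀ t, s ≤ t → t < m → ∃ j, C.ExtVanish k (PStd A e j) ∧ ∃ p : X t →ₗ[A] PStd A e j,
        Function.Surjective p ∧ ∀ x : X t, p x = 0 ↔ (x : M) ∈ X (t + 1)) :
    C.ExtVanish k (X s) := by
  induction hs using Nat.decreasingInduction with
  | self =>
    rw [hm]
    exact InjCoresolution.extVanish_of_subsingleton k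
  | of_succ s hs ih =>
    obtain ⟨j, hj, p, hp, hpX⟩ := h s le_rfl hs
    refine InjCoresolution.ExtVanish.extension (i := Submodule.inclusion (hX s)) (p := p)
      (Submodule.inclusion_injective _) hp (fun x => ?_)
      (ih fun t ht => h t ((Nat.le_succ s).trans ht)) hj
    rw [hpX]
    exact ⟨fun hx => ⟨⟨x, hx⟩, rfl⟩, by rintro ⟨y, rfl⟩; exact y.2⟩

end Filtration

section Main

variable {K : Type*} [Field K] [IsAlgClosed K] {A : Type u} [Ring A] [Algebra K A]
  [FiniteDimensional K A] {n : ℕ} {e : Fin n → A} (hidem : ∀ i, IsPrimitiveIdem A (e i))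
  (hbasic : ∀ i j, i ≠ j → ¬ Nonempty (↥(leftIdeal A (e i)) ≃ₗ[A] ↥(leftIdeal A (e j))))

variable (K) in
include hidem hbasic K in
theorem surjective_pstd_eq_zero_iff {j l : Fin n}
    {p : leftIdeal A (e j) →ₗ[A] PStd A e l} (hp : Function.Surjective p)
    (y : leftIdeal A (e j)) : p y = 0 ↔ y ∈ properU A e j := by
  have hpy : ∀ y, p y = (y : A) • p (leftIdealGen (e j)) := fun y => by
    rw [← map_smul, ← leftIdeal_eq_smul_gen (hidem j).1 y]
  have hg : e j • p (leftIdealGen (e j)) = p (leftIdealGen (e j)) :=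
    (hpy (leftIdealGen (e j))).symm
  obtain ⟨z, hz⟩ := hp (pstdGen e l)
  obtain rfl : j = l := by
    by_contra hjl
    obtain ⟨w, hw⟩ := exists_smul_pstdGen hidem (p (leftIdealGen (e j)))
    have hc : e l * z * e j ∈ jacRad A := by
      refine (hidem l).mem_jacRad (K := K) (hidem j) (hbasic l j (Ne.symm hjl)) ?_ ?_
      · rw [← mul_assoc, ← mul_assoc, (hidem l).1.eq]
      · rw [mul_assoc, (hidem j).1.eq]
    have h0 := smul_pstdGen_eq_zero hidem le_rfl (mul_mem_jacRad hc w) (by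
      rw [← mul_assoc, ← mul_assoc, ← mul_assoc, (hidem l).1.eq])
    refine pstdGen_ne_zero hidem l ?_
    rw [← idem_smul_pstdGen hidem, ← hz, hpy z, ← h0, mul_smul, ← hw, mul_smul, hg, mul_smul]
  obtain ⟨r, hr⟩ := exists_smul_pstdGen_eq hidem K hg
  have hr0 : r ≠ 0 := by
    rintro rfl
    refine pstdGen_ne_zero hidem j ?_
    rw [← hz, hpy, hr, zero_smul, smul_zero]
  rw [hpy, hr, smul_comm, smul_pstdGen hidem, smul_eq_zero_iff_right hr0]
  exact Submodule.Quotient.mk_eq_zero _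

variable (hfilt : ∀ i, HasPStdFilt A e (fun j => i ≤ j) ↥(leftIdeal A (e i)))

variable (K) in
include hidem hbasic hfilt K in
theorem extVanish_properU {L : Type u} [AddCommGroup L] [Module A L] {C : InjCoresolution A L}
    {k : ℕ} {j : Fin n} (h : ∀ l, j ≤ l → C.ExtVanish k (PStd A e l)) :
    C.ExtVanish k (properU A e j) := by
  obtain ⟨m, X, h0, hm, hX, hp⟩ := (hfilt j).exists_maps
  have hm0 : 0 < m := by
    rcases Nat.eq_zero_or_pos m with rfl | h
    · have : leftIdealGen (e j) ∈ (⊥ : Submodule A (leftIdeal A (e j))) := by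
        rw [← hm, h0]
        trivial
      exact absurd (congrArg Subtype.val ((Submodule.mem_bot A).1 this)) (hidem j).2.1
    · exact h
  obtain ⟨l, hl, p, hpl, hpX⟩ := hp 0 hm0
  have hin : ∀ y, y ∈ X 0 := fun y => h0 ▸ Submodule.mem_top
  have hX1 : X 1 = properU A e j := by
    ext y
    rw [← surjective_pstd_eq_zero_iff K hidem hbasic
      (p := p ∘ₗ LinearMap.codRestrict (X 0) LinearMap.id hin)
      (fun v => (hpl v).elim fun y hy => ⟨y, hy⟩) y]
    exact (hpX ⟨y, hin y⟩).symm
  rw [← hX1]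
  refine extVanish_filtration (e := e) hm hX hm0 fun t _ ht => ?_
  obtain ⟨l, hl, h1⟩ := hp t ht
  exact ⟨l, h l hl, h1⟩

variable (K) in
include hidem hbasic hfilt K in
theorem extVanish_pstd_of_lt {i : Fin n} (C : InjCoresolution A (PStd A e i)) (k : ℕ) :
    ∀ j, i < j → C.ExtVanish k (PStd A e j) := by
  induction k with
  | zero =>
    refine fun j hij => InjCoresolution.extVanish_zero_of_hom_eq_zero fun f =>
      LinearMap.ext fun v => ?_
    obtain ⟨y, rfl⟩ := exists_smul_pstdGen hidem v
    rw [map_smul, ← idem_smul_pstdGen hidem, map_smul,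
      idem_smul_pstd_eq_zero hidem hbasic K hij, smul_zero, LinearMap.zero_apply]
  | succ k ih =>
    intro j hij
    have := leftIdeal_projective (hidem j).1
    exact InjCoresolution.ExtVanish.of_coker (i := (properU A e j).subtype)
      (p := (properU A e j).mkQ) (Submodule.subtype_injective _) (Submodule.mkQ_surjective _)
      (LinearMap.exact_subtype_mkQ _)
      (extVanish_properU K hidem hbasic hfilt fun l hl => ih l (hij.trans_le hl))
      (InjCoresolution.Acyclic.of_projective k)

variable (K) in
include hidem in
theorem finrank_idemPart_pstd (i : Fin n) :
    Module.finrank K (idemPart K (e i) (PStd A e i)) = 1 := by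
  refine finrank_eq_one_iff'.2 ⟨⟨pstdGen e i,
    (mem_idemPart (hidem i).1).2 (idem_smul_pstdGen hidem i)⟩,
    fun h => pstdGen_ne_zero hidem i (congrArg Subtype.val h), ?_⟩
  rintro ⟨v, hv⟩
  obtain ⟨r, hr⟩ := exists_smul_pstdGen_eq hidem K ((mem_idemPart (hidem i).1).1 hv)
  exact ⟨r, Subtype.ext hr.symm⟩

omit [IsAlgClosed K] in
include hidem hbasic in
/-- The submodule of `P(i)` with `Δ̄(j)`-filtration, `j > i`, collecting the corresponding layers
of a filtration of `P(i)`. -/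
theorem exists_layer {i : Fin n} (C : InjCoresolution A (PStd A e i)) (c : ℤ)
    (hc : chi K (e i) c (PStd A e i) = 0) {m : ℕ} {X : ℕ → Submodule A (leftIdeal A (e i))}
    (hm : X m = ⊥) (hX : ∀ t, X (t + 1) ≤ X t)
    (h : ∀ t < m, ∃ j, i ≤ j ∧ ∃ p : X t →ₗ[A] PStd A e j,
        Function.Surjective p ∧ ∀ x : X t, p x = 0 ↔ (x : leftIdeal A (e i)) ∈ X (t + 1))
    (hvan : ∀ k j, i < j → C.ExtVanish k (PStd A e j))
    {s : ℕ} (hs : s ≤ m) :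
    ∃ Y : Submodule A (leftIdeal A (e i)), Y ≤ X s ∧ Y ≤ stdU A e i ∧
      (∀ k, C.ExtVanish k Y) ∧ (∀ l, i < l → ∀ x ∈ X s, e l • x ∈ Y) ∧
      chi K (e i) c (X s) = chi K (e i) c Y := by
  have hfin : ∀ N : Submodule A (leftIdeal A (e i)), FiniteDimensional K N := fun N =>
    Module.Finite.of_injective (((leftIdeal A (e i)).subtype ∘ₗ N.subtype).restrictScalars K)
      (Subtype.val_injective.comp Subtype.val_injective)
  induction hs using Nat.decreasingInduction with
  | self =>
    refine ⟨⊥, bot_le, bot_le, fun k => InjCoresolution.extVanish_of_subsingleton k,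
      fun l _ x hx => ?_, by rw [hm]⟩
    rw [hm] at hx
    rw [(Submodule.mem_bot A).1 hx, smul_zero]
    exact Submodule.zero_mem _
  | of_succ s hs ih =>
    obtain ⟨Y, hYX, hYU, hYE, hYl, hYc⟩ := ih
    obtain ⟨j, hij, p, hp, hpX⟩ := h s hs
    have hχ := chi_eq_add_of_exact (K := K) (hidem i).1 c (i := Submodule.inclusion (hX s))
      (p := p) (Submodule.inclusion_injective _) hp (fun x => by
        rw [hpX]
        exact ⟨fun hx => ⟨⟨x, hx⟩, rfl⟩, by rintro ⟨y, rfl⟩; exact y.2⟩)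
    rcases hij.eq_or_lt with rfl | hij
    · refine ⟨Y, hYX.trans (hX s), hYU, hYE, fun l hl x hx => ?_, by rw [hχ, hc, add_zero, hYc]⟩
      have h1 : e l • x ∈ X (s + 1) := by
        have := (hpX (e l • ⟨x, hx⟩)).1 (by
          rw [map_smul]
          exact idem_smul_pstd_eq_zero hidem hbasic K hl _)
        exact this
      rw [← idem_smul_self hidem l x]
      exact hYl l hl _ h1
    · obtain ⟨g₀, hg₀⟩ := hp (pstdGen e j)
      set g : X s := e j • g₀ with hgdef
      have hg : p g = pstdGen e j := by rw [map_smul, hg₀, idem_smul_pstdGen hidem]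
      have hjg : e j • g = g := idem_smul_self hidem j g₀
      have hjg' : e j • (g : leftIdeal A (e i)) = g := congrArg Subtype.val hjg
      have hU : ∀ y ∈ properU A e j, (y : A) • (g : leftIdeal A (e i)) ∈ Y := by
        have : properU A e j ≤
            Submodule.comap (leftIdealHom (e j) (g : leftIdeal A (e i))) Y := by
          refine properU_le hidem fun l hl y hy hly => ?_
          rw [Submodule.mem_comap, ← hly, map_smul]
          refine hYl l (hij.trans_le hl) _ ((hpX ((y : A) • g)).1 ?_)
          rw [map_smul, hg]
          exact smul_pstdGen_eq_zero hidem hl hy (congrArg Subtype.val hly)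
        exact this
      have hker : ∀ a : A, p (a • g) = 0 → a • (g : leftIdeal A (e i)) ∈ Y := by
        intro a ha
        rw [map_smul, hg] at ha
        have := hU (a • leftIdealGen (e j)) ((Submodule.Quotient.mk_eq_zero _).1 ha)
        change (a * e j) • (g : leftIdeal A (e i)) ∈ Y at this
        rwa [mul_smul, hjg'] at this
      set Y' := Y ⊔ Submodule.span A {(g : leftIdeal A (e i))} with hY'
      have hY'X : Y' ≤ X s :=
        sup_le (hYX.trans (hX s)) ((Submodule.span_singleton_le_iff_mem _ _).2 g.2)
      have hmem : ∀ y ∈ Y', ∃ z ∈ Y, ∃ a : A, z + a • (g : leftIdeal A (e i)) = y := by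
        intro y hy
        obtain ⟨z, hz, w, hw, rfl⟩ := Submodule.mem_sup.1 hy
        obtain ⟨a, rfl⟩ := Submodule.mem_span_singleton.1 hw
        exact ⟨z, hz, a, rfl⟩
      have hag : ∀ a : A, a • (g : leftIdeal A (e i)) ∈ Y' := fun a =>
        Submodule.smul_mem _ _ (Submodule.mem_sup_right (Submodule.mem_span_singleton_self _))
      have hYY' : Y ≤ Y' := le_sup_left
      have hsurj : Function.Surjective (p ∘ₗ Submodule.inclusion hY'X) := by
        intro v
        obtain ⟨a, rfl⟩ := exists_smul_pstdGen hidem v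
        refine ⟨⟨(a : A) • (g : leftIdeal A (e i)), hag a⟩, ?_⟩
        rw [← hg, ← map_smul]
        rfl
      have hexact : Function.Exact (Submodule.inclusion hYY')
          (p ∘ₗ Submodule.inclusion hY'X) := by
        rintro ⟨y, hy⟩
        refine ⟨fun h0 => ?_, ?_⟩
        · obtain ⟨z, hz, a, rfl⟩ := hmem y hy
          have h1 : p (⟨z, hX s (hYX hz)⟩ + a • g) = 0 := h0
          rw [map_add, (hpX ⟨z, hX s (hYX hz)⟩).2 (hYX hz), zero_add] at h1
          exact ⟨⟨_, Y.add_mem hz (hker a h1)⟩, rfl⟩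
        · rintro ⟨z, hz⟩
          have hz' : (z : leftIdeal A (e i)) = y := congrArg Subtype.val hz
          refine (hpX ⟨y, hY'X hy⟩).2 ?_
          change y ∈ X (s + 1)
          rw [← hz']
          exact hYX z.2
      refine ⟨Y', hY'X, sup_le hYU ((Submodule.span_singleton_le_iff_mem _ _).2
        (mem_stdU hij hjg')), fun k => (hYE k).extension (Submodule.inclusion_injective hYY') hsurj
          hexact (hvan k j hij), fun l hl x hx => ?_, ?_⟩
      · obtain ⟨a, ha⟩ := exists_smul_pstdGen hidem (p ⟨x, hx⟩)
        have h1 : x - (a : A) • (g : leftIdeal A (e i)) ∈ X (s + 1) :=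
          (hpX (⟨x, hx⟩ - (a : A) • g)).1 (by rw [map_sub, map_smul, hg, ha, sub_self])
        have h2 := Y'.add_mem (hYY' (hYl l hl _ h1)) (hag (e l * a))
        rwa [smul_sub, mul_smul, sub_add_cancel] at h2
      · rw [hχ, hYc, chi_eq_add_of_exact (K := K) (hidem i).1 c
          (Submodule.inclusion_injective hYY') hsurj hexact]

variable (K) in
include hidem hbasic hfilt in
theorem acyclic_std_and_finrank_eq {i : Fin n} (C : InjCoresolution A (PStd A e i)) :
    C.Acyclic (Std A e i) ∧ Module.finrank K (Std A e i) =
      Module.finrank K (PStd A e i) * Module.finrank K (idemPart K (e i) (Std A e i)) := by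
  obtain ⟨c, hcdef⟩ : ∃ c : ℤ, c = Module.finrank K (PStd A e i) := ⟨_, rfl⟩
  have hc : chi K (e i) c (PStd A e i) = 0 := by
    rw [chi, hcdef, finrank_idemPart_pstd K hidem, Nat.cast_one, mul_one, sub_self]
  obtain ⟨m, X, h0, hm, hX, hp⟩ := (hfilt i).exists_maps
  obtain ⟨Y, -, hYU, hYE, hYl, hYc⟩ := exists_layer hidem hbasic C c hc hm hX hp
    (extVanish_pstd_of_lt K hidem hbasic hfilt C) (Nat.zero_le m)
  obtain rfl : Y = stdU A e i := le_antisymm hYU (stdU_le hidem fun j hj y hy =>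
    hy ▸ hYl j hj y (h0 ▸ Submodule.mem_top))
  have hproj := leftIdeal_projective (hidem i).1
  have hfin : FiniteDimensional K (leftIdeal A (e i)) :=
    Module.Finite.of_injective ((leftIdeal A (e i)).subtype.restrictScalars K)
      Subtype.val_injective
  refine ⟨fun k => InjCoresolution.ExtVanish.of_coker (Submodule.subtype_injective _)
    (Submodule.mkQ_surjective _) (LinearMap.exact_subtype_mkQ _) (hYE k)
    (InjCoresolution.Acyclic.of_projective k), ?_⟩
  have h1 := chi_eq_add_of_exact (K := K) (hidem i).1 c
    (Submodule.subtype_injective (stdU A e i)) (Submodule.mkQ_surjective (stdU A e i))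
    (LinearMap.exact_subtype_mkQ (stdU A e i))
  have h2 : chi K (e i) c (leftIdeal A (e i)) = chi K (e i) c (X 0) := by
    rw [chi_eq_add_of_exact (K := K) (hidem i).1 c (X 0).subtype_injective
      (X 0).mkQ_surjective (LinearMap.exact_subtype_mkQ (X 0)), add_eq_left]
    have : Subsingleton (leftIdeal A (e i) ⧸ X 0) := by
      rw [h0]
      infer_instance
    simp [chi, Module.finrank_zero_of_subsingleton]
  have h3 : chi K (e i) c (Std A e i) = 0 := by
    rw [h2, hYc] at h1
    exact left_eq_add.1 h1
  rw [chi, sub_eq_zero, hcdef] at h3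
  exact_mod_cast h3

end Main

section EndBasis

open Module MulOpposite

variable {A : Type*} [Ring A] {Δ : Type*} [AddCommGroup Δ] [Module A Δ] {m : ℕ}
  (b : Basis (Fin m) (Module.End A Δ) Δ)

theorem repr_smul_eq_sum (a : A) (x : Δ) (u : Fin m) :
    b.repr (a • x) u = ∑ s, b.repr x s * b.repr (a • b s) u := by
  have h : a • x = ∑ s, b.repr x s • a • b s := by
    conv_lhs => rw [← b.sum_repr x, Finset.smul_sum]
    exact Finset.sum_congr rfl fun s _ => (map_smul (b.repr x s) a (b s)).symm
  rw [h, map_sum, Finsupp.finsetSum_apply]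
  exact Finset.sum_congr rfl fun s _ => by rw [map_smul, Finsupp.smul_apply, smul_eq_mul]

/-- The matrices of the action of `A` with respect to a basis over the endomorphism ring. -/
def actMatrix : A →+* Matrix (Fin m) (Fin m) (Module.End A Δ)ᵐᵒᵖ where
  toFun a := Matrix.of fun u s => op (b.repr (a • b s) u)
  map_one' := by
    ext u s
    rw [Matrix.of_apply, one_smul, b.repr_self, Finsupp.single_apply, Matrix.one_apply]
    by_cases h : u = s
    · rw [if_pos h, if_pos h.symm, op_one]
    · rw [if_neg h, if_neg (Ne.symm h), op_zero]
  map_mul' a c := by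
    ext u s
    rw [Matrix.mul_apply, Matrix.of_apply, mul_smul, repr_smul_eq_sum]
    exact map_sum opAddEquiv _ _
  map_zero' := by
    ext u s
    simp
  map_add' a c := by
    ext u s
    simp [add_smul]

theorem actMatrix_algebraMap {K : Type*} [Field K] [Algebra K A] [Module K Δ]
    [IsScalarTower K A Δ] (c : K) : actMatrix b (algebraMap K A c) =
      Matrix.scalar (Fin m) (algebraMap K (Module.End A Δ)ᵐᵒᵖ c) := by
  ext u s
  change op (b.repr (algebraMap K A c • b s) u) = _
  have h : algebraMap K A c • b s = algebraMap K (Module.End A Δ) c • b s :=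
    algebraMap_smul A c (b s)
  rw [h, map_smul, Matrix.scalar_apply, Matrix.diagonal_apply, b.repr_self, Finsupp.smul_apply,
    Finsupp.single_apply]
  by_cases h : u = s
  · rw [if_pos h, if_pos h.symm, smul_eq_mul, mul_one]
    rfl
  · rw [if_neg h, if_neg (Ne.symm h), smul_zero, op_zero]

/-- The coordinates with respect to a basis over the endomorphism ring, as an `A`-linear
isomorphism. -/
def matModEquiv : Δ ≃ₗ[A] MatMod (actMatrix b) (Module.End A Δ)ᵐᵒᵖ where
  toFun x := MatMod.of _ fun s => op (b.repr x s)
  invFun v := ∑ s, unop (MatMod.coord _ v s) • b s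
  map_add' x y := MatMod.ext fun s => by simp
  map_smul' a x := MatMod.ext fun s => by
    rw [MatMod.coord_of, repr_smul_eq_sum]
    exact map_sum opAddEquiv _ _
  left_inv x := b.sum_repr x
  right_inv v := MatMod.ext fun s => by
    rw [MatMod.coord_of, b.repr_sum_self]
    rfl

end EndBasis

section Local

open Module MulOpposite

variable {K : Type*} [Field K] {A : Type*} [Ring A] [Algebra K A]
  {Δ L : Type*} [AddCommGroup Δ] [Module A Δ] [Module K Δ] [IsScalarTower K A Δ]
  [AddCommGroup L] [Module A L] [Module K L] [IsScalarTower K A L]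
  {π : Δ →ₗ[A] L} (hπ : Function.Surjective π) (hHom : ∀ f : Δ →ₗ[A] L, ∃ r : K, f = r • π)
  (hnil : ∀ ν : Module.End A Δ, π ∘ₗ ν = 0 → IsNilpotent ν)

omit [Module K Δ] [IsScalarTower K A Δ] in
include hHom in
theorem comp_comp_eq_zero {ν : Module.End A Δ} (hν : π ∘ₗ ν = 0) (δ : Module.End A Δ) :
    π ∘ₗ (δ * ν) = 0 := by
  obtain ⟨r, hr⟩ := hHom (π ∘ₗ δ)
  change (π ∘ₗ δ) ∘ₗ ν = 0
  rw [hr, LinearMap.smul_comp, hν, smul_zero]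

omit [Module K Δ] [IsScalarTower K A Δ] in
include hHom hnil in
theorem mem_jacRad_end {ν : Module.End A Δ} (hν : π ∘ₗ ν = 0) : ν ∈ jacRad (Module.End A Δ) :=
  mem_jacRad_of_isNilpotent fun δ => hnil _ (comp_comp_eq_zero hHom hν δ)

include hHom hnil in
theorem isUnit_of_comp_ne_zero {δ : Module.End A Δ} (hδ : π ∘ₗ δ ≠ 0) : IsUnit δ := by
  obtain ⟨r, hr⟩ := hHom (π ∘ₗ δ)
  have hr0 : r ≠ 0 := by
    rintro rfl
    exact hδ (by rw [hr, zero_smul])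
  have h1 : IsNilpotent (δ - algebraMap K _ r) := hnil _ (by
    rw [LinearMap.comp_sub, hr, sub_eq_zero]
    ext x
    exact (π.map_smul_of_tower r x).symm)
  have h2 : IsUnit (algebraMap K (Module.End A Δ) r) := (IsUnit.mk0 r hr0).map _
  have h3 := h1.isUnit_add_left_of_commute h2 (Algebra.commutes' r _).symm
  rwa [add_sub_cancel] at h3

include hHom hnil in
theorem mem_jacRad_endOp (hπ0 : π ≠ 0) (x : (Module.End A Δ)ᵐᵒᵖ) :
    x ∈ jacRad (Module.End A Δ)ᵐᵒᵖ ↔ π ∘ₗ unop x = 0 := by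
  let I : Ideal (Module.End A Δ)ᵐᵒᵖ :=
    { carrier := {x | π ∘ₗ unop x = 0}
      add_mem' := fun {x y} hx hy => by
        change π ∘ₗ (unop x + unop y) = 0
        rw [LinearMap.comp_add, show π ∘ₗ unop x = 0 from hx, show π ∘ₗ unop y = 0 from hy,
          add_zero]
      zero_mem' := LinearMap.comp_zero π
      smul_mem' := fun r x hx => by
        change (π ∘ₗ unop x) ∘ₗ unop r = 0
        rw [show π ∘ₗ unop x = 0 from hx, LinearMap.zero_comp] }
  have hI : I ≠ ⊤ := fun h => hπ0 ((Ideal.eq_top_iff_one I).1 h)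
  rw [jacRad_eq_of_isUnit hI fun x hx => isUnit_unop.1 (isUnit_of_comp_ne_zero hHom hnil hx)]
  rfl

end Local

section LocalBasis

open Module MulOpposite

variable {K : Type*} [Field K] {A : Type*} [Ring A] [Algebra K A]
  {Δ L : Type*} [AddCommGroup Δ] [Module A Δ] [Module K Δ] [IsScalarTower K A Δ]
  [AddCommGroup L] [Module A L] [Module K L] [IsScalarTower K A L]
  {π : Δ →ₗ[A] L} (hπ : Function.Surjective π) (hHom : ∀ f : Δ →ₗ[A] L, ∃ r : K, f = r • π)
  (hnil : ∀ ν : Module.End A Δ, π ∘ₗ ν = 0 → IsNilpotent ν)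

omit [Module K Δ] [IsScalarTower K A Δ] in
include hHom hnil in
theorem ker_subset_jacobson_smul_top
    (hker : LinearMap.ker π ≤ Submodule.span A
      {z | ∃ ν : Module.End A Δ, π ∘ₗ ν = 0 ∧ ∃ y, ν y = z})
    {x : Δ} (hx : π x = 0) :
    x ∈ Ring.jacobson (Module.End A Δ) • (⊤ : Submodule (Module.End A Δ) Δ) := by
  have hsmul : ∀ (a : A), ∀ z ∈ Ring.jacobson (Module.End A Δ) •
      (⊤ : Submodule (Module.End A Δ) Δ), a • z ∈ Ring.jacobson (Module.End A Δ) •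
      (⊤ : Submodule (Module.End A Δ) Δ) := by
    intro a z hz
    refine Submodule.smul_induction_on hz (fun ν hν y _ => ?_) fun y z hy hz => ?_
    · have h : a • ν • y = ν • a • y := (map_smul ν a y).symm
      rw [h]
      exact Submodule.smul_mem_smul hν Submodule.mem_top
    · rw [smul_add]
      exact Submodule.add_mem _ hy hz
  refine Submodule.span_induction ?_ (Submodule.zero_mem _)
    (fun y z _ _ hy hz => Submodule.add_mem _ hy hz) (fun a z _ hz => hsmul a z hz) (hker hx)
  rintro _ ⟨ν, hν, y, rfl⟩
  refine Submodule.smul_mem_smul ?_ Submodule.mem_top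
  rw [Ring.jacobson_eq_sInf_isMaximal]
  exact mem_jacRad_end hHom hnil hν

include hπ hHom hnil in
/-- A module over its endomorphism ring is free when the dimensions match. -/
theorem exists_basis_end [FiniteDimensional K Δ] [FiniteDimensional K L]
    (hker : LinearMap.ker π ≤ Submodule.span A
      {z | ∃ ν : Module.End A Δ, π ∘ₗ ν = 0 ∧ ∃ y, ν y = z})
    (hdim : finrank K Δ = finrank K L * finrank K (Module.End A Δ)) :
    ∃ b : Basis (Fin (finrank K L)) (Module.End A Δ) Δ,
      LinearIndependent K fun s => π (b s) := by
  let β := finBasis K L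
  choose v hv using fun s => hπ (β s)
  have : FiniteDimensional K (Module.End A Δ) :=
    FiniteDimensional.of_injective (LinearMap.restrictScalarsₗ K A Δ Δ K)
      (LinearMap.restrictScalars_injective K)
  have hfin : Module.Finite (Module.End A Δ) Δ :=
    Module.Finite.of_restrictScalars_finite K (Module.End A Δ) Δ
  have hspan : Submodule.span (Module.End A Δ) (Set.range v) = ⊤ := by
    rw [← Submodule.Quotient.subsingleton_iff, ← Submodule.subsingleton_iff (Module.End A Δ)]
    refine subsingleton_of_bot_eq_top ((Module.Finite.fg_top).eq_bot_of_le_jacobson_smul ?_).symm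
    rintro w -
    obtain ⟨x, rfl⟩ := Submodule.mkQ_surjective _ w
    have hx : π (x - ∑ s, β.repr (π x) s • v s) = 0 := by
      rw [map_sub, map_sum, sub_eq_zero]
      conv_lhs => rw [← β.sum_repr (π x)]
      exact Finset.sum_congr rfl fun s _ => by rw [π.map_smul_of_tower, hv]
    have h0 : (Submodule.span (Module.End A Δ) (Set.range v)).mkQ
        (∑ s, β.repr (π x) s • v s) = 0 := by
      rw [Submodule.mkQ_apply, Submodule.Quotient.mk_eq_zero]
      exact Submodule.sum_mem _ fun s _ => Submodule.smul_of_tower_mem _ _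
        (Submodule.subset_span ⟨s, rfl⟩)
    have h1 := Submodule.mem_map_of_mem (f := (Submodule.span (Module.End A Δ) (Set.range v)).mkQ)
      (ker_subset_jacobson_smul_top hHom hnil hker hx)
    rw [map_sub, h0, sub_zero, Submodule.map_smul'', Submodule.map_top, Submodule.range_mkQ] at h1
    exact h1
  have hsurj : Function.Surjective
      ((Fintype.linearCombination (Module.End A Δ) v).restrictScalars K) := by
    rw [LinearMap.coe_restrictScalars, ← LinearMap.range_eq_top,
      Fintype.range_linearCombination, hspan]
  have hinj := (LinearMap.injective_iff_surjective_of_finrank_eq_finrank (by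
    rw [finrank_pi_fintype, Finset.sum_const, Finset.card_univ, Fintype.card_fin, hdim,
      smul_eq_mul])).2 hsurj
  have hli : LinearIndependent (Module.End A Δ) v :=
    linearIndependent_iff_injective_fintypeLinearCombination.2 hinj
  refine ⟨Basis.mk hli hspan.ge, ?_⟩
  have : (fun s => π (Basis.mk hli hspan.ge s)) = β := by
    funext s
    rw [Basis.mk_apply, hv]
  rw [this]
  exact β.linearIndependent

section

variable {m : ℕ} (b : Basis (Fin m) (Module.End A Δ) Δ)
  (hb : LinearIndependent K fun s => π (b s)) (hπ0 : π ≠ 0)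

include hπ hHom hnil hb hπ0 in
theorem exists_matMod_equiv :
    ∃ ι : MatMod (actMatrix b) ((Module.End A Δ)ᵐᵒᵖ ⧸ jacRad (Module.End A Δ)ᵐᵒᵖ) ≃ₗ[A] L,
      ∀ x, ι (MatMod.map _ (jacRad (Module.End A Δ)ᵐᵒᵖ).mkQ (matModEquiv b x)) = π x := by
  obtain ⟨ι, hι⟩ := exists_linearEquiv_of_same_ker
    (MatMod.map (actMatrix b) (jacRad (Module.End A Δ)ᵐᵒᵖ).mkQ)
    (MatMod.map_surjective _ (Submodule.mkQ_surjective _))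
    (π ∘ₗ (matModEquiv b).symm.toLinearMap) (hπ.comp (matModEquiv b).symm.surjective) (by
      intro v
      choose r hr using fun s => hHom (π ∘ₗ unop (MatMod.coord _ v s))
      have h1 : (π ∘ₗ (matModEquiv b).symm.toLinearMap) v = ∑ s, r s • π (b s) := by
        change π (∑ s, unop (MatMod.coord _ v s) • b s) = _
        rw [map_sum]
        refine Finset.sum_congr rfl fun s _ => ?_
        exact LinearMap.congr_fun (hr s) (b s)
      have h2 : ∀ s, MatMod.coord _ v s ∈ jacRad (Module.End A Δ)ᵐᵒᵖ ↔ r s = 0 := by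
        intro s
        rw [mem_jacRad_endOp hHom hnil hπ0, hr, smul_eq_zero_iff_left hπ0]
      rw [h1]
      constructor
      · intro h
        refine Finset.sum_eq_zero fun s _ => ?_
        rw [(h2 s).1 ((Submodule.Quotient.mk_eq_zero _).1
          (congrArg (fun w => MatMod.coord _ w s) h)), zero_smul]
      · intro h
        refine MatMod.ext fun s => (Submodule.Quotient.mk_eq_zero _).2 ((h2 s).2 ?_)
        exact Fintype.linearIndependent_iff.1 hb r h s)
  exact ⟨ι, fun x => by simpa using hι (matModEquiv b x)⟩

include hHom in
theorem exists_matMod_map_eq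
    (ι : MatMod (actMatrix b) ((Module.End A Δ)ᵐᵒᵖ ⧸ jacRad (Module.End A Δ)ᵐᵒᵖ) ≃ₗ[A] L)
    (hι : ∀ x, ι (MatMod.map _ (jacRad (Module.End A Δ)ᵐᵒᵖ).mkQ (matModEquiv b x)) = π x)
    (τ : MatMod (actMatrix b) (Module.End A Δ)ᵐᵒᵖ →ₗ[A]
      MatMod (actMatrix b) ((Module.End A Δ)ᵐᵒᵖ ⧸ jacRad (Module.End A Δ)ᵐᵒᵖ)) :
    ∃ σ : (Module.End A Δ)ᵐᵒᵖ →ₗ[(Module.End A Δ)ᵐᵒᵖ]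
      ((Module.End A Δ)ᵐᵒᵖ ⧸ jacRad (Module.End A Δ)ᵐᵒᵖ), MatMod.map (actMatrix b) σ = τ := by
  obtain ⟨r, hr⟩ := hHom (ι.toLinearMap ∘ₗ τ ∘ₗ (matModEquiv b).toLinearMap)
  refine ⟨LinearMap.toSpanSingleton _ _ (Submodule.Quotient.mk (algebraMap K _ r)), ?_⟩
  ext v
  obtain ⟨x, rfl⟩ := (matModEquiv b).surjective v
  apply ι.injective
  have h1 : ι (τ (matModEquiv b x)) = π (r • x) := by
    rw [π.map_smul_of_tower]
    exact LinearMap.congr_fun hr x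
  rw [h1, ← hι]
  congr 1
  refine MatMod.ext fun s => ?_
  change Submodule.Quotient.mk (op (b.repr x s) * algebraMap K _ r) =
    Submodule.Quotient.mk (op (b.repr (r • x) s))
  congr 1
  have h2 : r • x = algebraMap K (Module.End A Δ) r • x := rfl
  rw [h2, map_smul]
  rfl

end

end LocalBasis

section StandardEnd

open Module

variable {A : Type*} [Ring A] {n : ℕ} {e : Fin n → A}

/-- The generator of the standard module. -/
def stdGen (e : Fin n → A) (i : Fin n) : Std A e i :=
  Submodule.Quotient.mk (leftIdealGen (e i))

variable (hidem : ∀ i, IsPrimitiveIdem A (e i))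

include hidem

theorem smul_stdGen {i : Fin n} (y : leftIdeal A (e i)) :
    (y : A) • stdGen e i = Submodule.Quotient.mk y :=
  (congrArg Submodule.Quotient.mk (leftIdeal_eq_smul_gen (hidem i).1 y)).symm

theorem idem_smul_stdGen (i : Fin n) : e i • stdGen e i = stdGen e i :=
  smul_stdGen hidem (leftIdealGen (e i))

theorem std_hom_ext {i : Fin n} {M : Type*} [AddCommGroup M] [Module A M]
    {f g : Std A e i →ₗ[A] M} (h : f (stdGen e i) = g (stdGen e i)) : f = g := by
  refine LinearMap.ext fun v => ?_
  obtain ⟨y, rfl⟩ := Submodule.Quotient.mk_surjective _ v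
  rw [← smul_stdGen hidem, map_smul, map_smul, h]

theorem exists_end_std {i : Fin n} {x : Std A e i} (hx : e i • x = x) :
    ∃ ν : Module.End A (Std A e i), ν (stdGen e i) = x :=
  ⟨(stdU A e i).liftQ (leftIdealHom (e i) x) fun _ hy =>
    smul_eq_zero_of_mem_stdU hidem (fun _ hij => idem_smul_std_eq_zero hidem hij) hy x, hx⟩

/-- Endomorphisms of the standard module correspond to elements of its part at `i`. -/
def endStdEquiv (K : Type*) [Field K] [Algebra K A] (i : Fin n) :
    Module.End A (Std A e i) ≃ₗ[K] idemPart K (e i) (Std A e i) :=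
  LinearEquiv.ofBijective
    { toFun := fun ν => ⟨ν (stdGen e i), (mem_idemPart (hidem i).1).2 (by
        rw [← map_smul, idem_smul_stdGen hidem])⟩
      map_add' := fun _ _ => rfl
      map_smul' := fun _ _ => rfl }
    ⟨fun _ _ h => std_hom_ext hidem (congrArg Subtype.val h), fun x =>
      (exists_end_std hidem ((mem_idemPart (hidem i).1).1 x.2)).imp fun _ hν => Subtype.ext hν⟩

variable (hbasic : ∀ i j, i ≠ j → ¬ Nonempty (↥(leftIdeal A (e i)) ≃ₗ[A] ↥(leftIdeal A (e j))))
  (K : Type*) [Field K] [Algebra K A] [FiniteDimensional K A]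

include hbasic K in
theorem stdU_le_properU (i : Fin n) : stdU A e i ≤ properU A e i :=
  stdU_le hidem fun j hij y hy => mem_properU hidem hij.le ((hidem j).mem_jacRad (K := K) (hidem i)
    (hbasic j i hij.ne') (congrArg Subtype.val hy) (leftIdeal_mul_eq (hidem i).1 y)) hy

/-- The projection from the standard to the properly standard module. -/
def stdProj {i : Fin n} (h : stdU A e i ≤ properU A e i) : Std A e i →ₗ[A] PStd A e i :=
  Submodule.factor h

omit hidem in
theorem stdProj_surjective {i : Fin n} (h : stdU A e i ≤ properU A e i) :
    Function.Surjective (stdProj h) := Submodule.factor_surjective h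

omit hidem in
theorem stdProj_mk {i : Fin n} (h : stdU A e i ≤ properU A e i) (y : leftIdeal A (e i)) :
    stdProj h (Submodule.Quotient.mk y) = Submodule.Quotient.mk y := rfl

theorem stdProj_ne_zero {i : Fin n} (h : stdU A e i ≤ properU A e i) : stdProj h ≠ 0 := fun h0 =>
  pstdGen_ne_zero hidem i (LinearMap.congr_fun h0 (stdGen e i))

theorem exists_eq_smul_stdProj [IsAlgClosed K] {i : Fin n} (h : stdU A e i ≤ properU A e i)
    (f : Std A e i →ₗ[A] PStd A e i) : ∃ r : K, f = r • stdProj h := by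
  obtain ⟨r, hr⟩ := exists_smul_pstdGen_eq hidem K (v := f (stdGen e i))
    (by rw [← map_smul, idem_smul_stdGen hidem])
  exact ⟨r, std_hom_ext hidem hr⟩

include K in
theorem isNilpotent_of_stdProj_comp {i : Fin n} (h : stdU A e i ≤ properU A e i)
    (ν : Module.End A (Std A e i)) (hν : stdProj h ∘ₗ ν = 0) : IsNilpotent ν := by
  have : IsArtinianRing A := IsArtinianRing.of_finite K A
  obtain ⟨y, hy⟩ := Submodule.Quotient.mk_surjective _ (ν (stdGen e i))
  have hyU : y ∈ properU A e i := by
    rw [← Submodule.Quotient.mk_eq_zero, ← stdProj_mk h, hy]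
    exact LinearMap.congr_fun hν (stdGen e i)
  obtain ⟨k, hk⟩ := isNilpotent_of_mem_jacRad (properU_coe_mem hidem hyU)
  have hpow : ∀ k, (ν ^ k) (stdGen e i) = (y : A) ^ k • stdGen e i := by
    intro k
    induction k with
    | zero => rw [pow_zero, pow_zero, one_smul, Module.End.one_apply]
    | succ k ih =>
      rw [pow_succ', Module.End.mul_apply, ih, map_smul, ← hy, ← smul_stdGen hidem, ← mul_smul,
        ← pow_succ]
  refine ⟨k, std_hom_ext hidem ?_⟩
  rw [hpow, hk, zero_smul, LinearMap.zero_apply]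

theorem ker_stdProj_le {i : Fin n} (h : stdU A e i ≤ properU A e i) :
    LinearMap.ker (stdProj h) ≤ Submodule.span A
      {z | ∃ ν : Module.End A (Std A e i), stdProj h ∘ₗ ν = 0 ∧ ∃ y, ν y = z} := by
  intro v hv
  obtain ⟨y, rfl⟩ := Submodule.Quotient.mk_surjective _ v
  rw [LinearMap.mem_ker, stdProj_mk, Submodule.Quotient.mk_eq_zero] at hv
  refine properU_le hidem (N := Submodule.comap (stdU A e i).mkQ (Submodule.span A
    {z | ∃ ν : Module.End A (Std A e i), stdProj h ∘ₗ ν = 0 ∧ ∃ y, ν y = z})) ?_ hv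
  intro j hij y hyJ hy
  rcases hij.lt_or_eq with hij | rfl
  · rw [Submodule.mem_comap, ← hy, map_smul, idem_smul_std_eq_zero hidem hij]
    exact Submodule.zero_mem _
  · obtain ⟨ν, hν⟩ := exists_end_std hidem
      (x := Submodule.Quotient.mk y) (congrArg Submodule.Quotient.mk hy)
    refine Submodule.subset_span ⟨ν, std_hom_ext hidem ?_, stdGen e i, hν⟩
    rw [LinearMap.comp_apply, hν, stdProj_mk]
    exact (Submodule.Quotient.mk_eq_zero _).2 (mem_properU hidem le_rfl hyJ hy)

end StandardEnd

section

open Module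

variable {K : Type u} [Field K] {A : Type u} [Ring A] [Algebra K A]
  {Δ L : Type u} [AddCommGroup Δ] [Module A Δ] [Module K Δ] [IsScalarTower K A Δ]
  [AddCommGroup L] [Module A L] [Module K L] [IsScalarTower K A L]
  [FiniteDimensional K Δ] [FiniteDimensional K L]

/-- The extension algebra of `L` agrees with that of the simple module over the opposite of the
endomorphism ring of `Δ` when `Δ` has top `L` over its endomorphism ring, has no higher extensions
by `L`, and has the dimension of a free module. -/
theorem exists_isGradedExtAlgIso_endOp {p : Δ →ₗ[A] L} (hp : Function.Surjective p) (hp0 : p ≠ 0)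
    (hHom : ∀ f : Δ →ₗ[A] L, ∃ r : K, f = r • p)
    (hnil : ∀ ν : Module.End A Δ, p ∘ₗ ν = 0 → IsNilpotent ν)
    (hker : LinearMap.ker p ≤ Submodule.span A
      {z | ∃ ν : Module.End A Δ, p ∘ₗ ν = 0 ∧ ∃ y, ν y = z})
    (hdim : finrank K Δ = finrank K L * finrank K (Module.End A Δ))
    (C : InjCoresolution A L) (hC : C.Acyclic Δ)
    (P : ℕ → Type u) [∀ l, AddCommGroup (P l)] [∀ l, Module A (P l)]
    [∀ l, Module K (P l)] [∀ l, IsScalarTower K A (P l)] [∀ l, SMulCommClass A K (P l)]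
    (hproj : ∀ l, Module.Projective A (P l))
    (dP : ∀ l, P (l + 1) →ₗ[A] P l)
    (π : P 0 →ₗ[A] L)
    (hπ : Function.Surjective π)
    (hex0 : Function.Exact (dP 0) π)
    (hex : ∀ l, Function.Exact (dP (l + 1)) (dP l))
    (P' : ℕ → Type u) [∀ l, AddCommGroup (P' l)] [∀ l, Module (Module.End A Δ)ᵐᵒᵖ (P' l)]
    [∀ l, Module K (P' l)] [∀ l, IsScalarTower K (Module.End A Δ)ᵐᵒᵖ (P' l)]
    [∀ l, SMulCommClass (Module.End A Δ)ᵐᵒᵖ K (P' l)]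
    (hproj' : ∀ l, Module.Projective (Module.End A Δ)ᵐᵒᵖ (P' l))
    (dP' : ∀ l, P' (l + 1) →ₗ[(Module.End A Δ)ᵐᵒᵖ] P' l)
    (π' : P' 0 →ₗ[(Module.End A Δ)ᵐᵒᵖ] (Module.End A Δ)ᵐᵒᵖ ⧸ jacRad (Module.End A Δ)ᵐᵒᵖ)
    (hπ' : Function.Surjective π')
    (hex0' : Function.Exact (dP' 0) π')
    (hex' : ∀ l, Function.Exact (dP' (l + 1)) (dP' l)) :
    ∃ φ : ∀ k, extQ P dP K k ≃ₗ[K] extQ P' dP' K k, IsGradedExtAlgIso P dP P' dP' K φ := by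
  obtain ⟨b, hb⟩ := exists_basis_end hp hHom hnil hker hdim
  obtain ⟨ι, hι⟩ := exists_matMod_equiv hp hHom hnil b hb hp0
  have : Nontrivial L := by
    by_contra h
    rw [not_nontrivial_iff_subsingleton] at h
    exact hp0 (LinearMap.ext fun x => Subsingleton.elim _ _)
  exact exists_isGradedExtAlgIso Module.finrank_pos (actMatrix b) (actMatrix_algebraMap b) ι
    (exists_matMod_map_eq hHom b ι hι) C (fun t => (hC t).of_equiv (matModEquiv b))
    P hproj dP π hπ hex0 hex P' hproj' dP' π' hπ' hex0' hex'

end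

theorem finite_quotient_of_tower (K : Type*) [Field K] {A : Type*} [Ring A] [Algebra K A]
    {M : Type*} [AddCommGroup M] [Module A M] [Module K M] [IsScalarTower K A M]
    [FiniteDimensional K M] (N : Submodule A M) : FiniteDimensional K (M ⧸ N) :=
  Module.Finite.of_surjective (N.mkQ.restrictScalars K) N.mkQ_surjective

theorem stmt11
    {K : Type u} [Field K] [IsAlgClosed K]
    {A : Type u} [Ring A] [Algebra K A] [FiniteDimensional K A]
    (n : ℕ) (e : Fin n → A)
    (hidem : ∀ i, IsPrimitiveIdem A (e i))
    (horth : ∀ i j, i ≠ j → e i * e j = 0)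
    (hcomplete : ∑ i, e i = 1)
    -- `A` is basic
    (hbasic : ∀ i j, i ≠ j → ¬ Nonempty (↥(leftIdeal A (e i)) ≃ₗ[A] ↥(leftIdeal A (e j))))
    -- `A` is `Δ̄`-filtered
    (hfilt : ∀ i, HasPStdFilt A e (fun j => i ≤ j) ↥(leftIdeal A (e i)))
    (i : Fin n)
    -- a projective resolution `P•` of `Δ̄(i)` over `A`
    (P : ℕ → Type u) [∀ l, AddCommGroup (P l)] [∀ l, Module A (P l)]
    [∀ l, Module K (P l)] [∀ l, IsScalarTower K A (P l)] [∀ l, SMulCommClass A K (P l)]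
    (hproj : ∀ l, Module.Projective A (P l))
    (dP : ∀ l, P (l + 1) →ₗ[A] P l)
    (π : P 0 →ₗ[A] PStd A e i)
    (hπ : Function.Surjective π)
    (hex0 : Function.Exact (dP 0) π)
    (hex : ∀ l, Function.Exact (dP (l + 1)) (dP l))
    -- a projective resolution `P'•` of `S_E` over `E = End_A(Δ(i))ᵒᵖ`
    (P' : ℕ → Type u) [∀ l, AddCommGroup (P' l)] [∀ l, Module (EndOpStd A e i) (P' l)]
    [∀ l, Module K (P' l)] [∀ l, IsScalarTower K (EndOpStd A e i) (P' l)]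
    [∀ l, SMulCommClass (EndOpStd A e i) K (P' l)]
    (hproj' : ∀ l, Module.Projective (EndOpStd A e i) (P' l))
    (dP' : ∀ l, P' (l + 1) →ₗ[EndOpStd A e i] P' l)
    (π' : P' 0 →ₗ[EndOpStd A e i] SimpleE A e i)
    (hπ' : Function.Surjective π')
    (hex0' : Function.Exact (dP' 0) π')
    (hex' : ∀ l, Function.Exact (dP' (l + 1)) (dP' l)) :
    -- conclusion: `Ext^*_A(Δ̄(i),Δ̄(i)) ≅ Ext^*_E(S_E,S_E)` as ℤ-graded `K`-algebras
    ∃ φ : ∀ k, extQ P dP K k ≃ₗ[K] extQ P' dP' K k,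
      IsGradedExtAlgIso P dP P' dP' K φ := by
  obtain ⟨C⟩ := InjCoresolution.nonempty A (PStd A e i)
  obtain ⟨hC, hdim⟩ := acyclic_std_and_finrank_eq K hidem hbasic hfilt C
  have hfin : FiniteDimensional K (leftIdeal A (e i)) :=
    Module.Finite.of_injective ((leftIdeal A (e i)).subtype.restrictScalars K)
      Subtype.val_injective
  have hfinS : FiniteDimensional K (Std A e i) := finite_quotient_of_tower K _
  have hfinP : FiniteDimensional K (PStd A e i) := finite_quotient_of_tower K _
  rw [← (endStdEquiv hidem K i).finrank_eq] at hdim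
  have hle := stdU_le_properU hidem hbasic K i
  exact exists_isGradedExtAlgIso_endOp (stdProj_surjective hle) (stdProj_ne_zero hidem hle)
    (exists_eq_smul_stdProj hidem K hle) (isNilpotent_of_stdProj_comp hidem K hle)
    (ker_stdProj_le hidem hle) hdim C hC P hproj dP π hπ hex0 hex P' hproj' dP' π' hπ' hex0' hex'

end
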